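/- There is an absolute constant c such that for any prime p, subsets A, B ⊆ F_p with |A| = A ≤ |B| = B, and λ, μ ∈ F_p^*, the number D*_{λ,μ}(A,B) of solutions of (a₁ − λa₂)(b₁ − μb₂) = (a₃ − λa₄)(b₃ − μb₄) ≠ 0 with aᵢ ∈ A, bᵢ ∈ B satisfies D*_{λ,μ}(A,B) ≤ c·(p^{1/2}A³B^{5/2} + A⁴B⁴/p). -/

import Mathlib

open Finset

/-- `D*_{λ,μ}(A,B)`: number of solutions of
`(a₁ − λa₂)(b₁ − μb₂) = (a₃ − λa₄)(b₃ − μb₄) ≠ 0` with `aᵢ ∈ A`, `bᵢ ∈ B`. -/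
def Dstar {p : ℕ} [Fact p.Prime] (A B : Finset (ZMod p)) (lam mu : ZMod p) : ℕ :=
  Fintype.card {t : (ZMod p × ZMod p × ZMod p × ZMod p) × (ZMod p × ZMod p × ZMod p × ZMod p) //
    t.1.1 ∈ A ∧ t.1.2.1 ∈ A ∧ t.1.2.2.1 ∈ A ∧ t.1.2.2.2 ∈ A ∧
    t.2.1 ∈ B ∧ t.2.2.1 ∈ B ∧ t.2.2.2.1 ∈ B ∧ t.2.2.2.2 ∈ B ∧
    (t.1.1 - lam * t.1.2.1) * (t.2.1 - mu * t.2.2.1)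
      = (t.1.2.2.1 - lam * t.1.2.2.2) * (t.2.2.2.1 - mu * t.2.2.2.2) ∧
    (t.1.1 - lam * t.1.2.1) * (t.2.1 - mu * t.2.2.1) ≠ 0}


namespace DS

section Basic
variable {K : Type} [Field K]

/-- Restriction of a polynomial to the line attached to `(a, m, c)`. -/
noncomputable def rho (q : K × K × K) : MvPolynomial (Fin 3) K →ₐ[K] Polynomial K :=
  MvPolynomial.aeval ![Polynomial.X, Polynomial.C q.2.1 - Polynomial.C q.1 * Polynomial.X,
    Polynomial.C (q.2.2 - q.2.1 * q.1) + Polynomial.C (q.1 ^ 2) * Polynomial.X]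

lemma rho_X0 (q : K × K × K) : rho q (MvPolynomial.X 0) = Polynomial.X := by simp [rho]
lemma rho_X1 (q : K × K × K) : rho q (MvPolynomial.X 1) =
    Polynomial.C q.2.1 - Polynomial.C q.1 * Polynomial.X := by simp [rho]
lemma rho_X2 (q : K × K × K) : rho q (MvPolynomial.X 2) =
    Polynomial.C (q.2.2 - q.2.1 * q.1) + Polynomial.C (q.1 ^ 2) * Polynomial.X := by simp [rho]
lemma rho_C (q : K × K × K) (x : K) : rho q (MvPolynomial.C x) = Polynomial.C x := by simp [rho]

lemma rho_natDegree (q : K × K × K) (F : MvPolynomial (Fin 3) K) :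
    (rho q F).natDegree ≤ F.totalDegree := by
  have := MvPolynomial.aeval_natDegree_le F (m := F.totalDegree) (n := 1) le_rfl
    ![Polynomial.X, Polynomial.C q.2.1 - Polynomial.C q.1 * Polynomial.X,
    Polynomial.C (q.2.2 - q.2.1 * q.1) + Polynomial.C (q.1 ^ 2) * Polynomial.X] (by
      intro i
      fin_cases i
      · simp
      · simp only [Fin.mk_one, Matrix.cons_val_one, Matrix.cons_val_zero]; compute_degree
      · simp only [Fin.reduceFinMk, Matrix.cons_val]; compute_degree)
  simpa [rho] using this

/-- box of polynomials -/
noncomputable def box (K : Type) [Field K] (D : Fin 3 → ℕ) : Submodule K (MvPolynomial (Fin 3) K) :=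
  MvPolynomial.restrictSupport K {n | ∀ i, n i < D i}

lemma mem_box {D : Fin 3 → ℕ} {p : MvPolynomial (Fin 3) K} :
    p ∈ box K D ↔ ∀ m ∈ p.support, ∀ i, m i < D i := by
  rw [box, MvPolynomial.mem_restrictSupport_iff]; rfl

lemma mem_box_of_degreeOf {D : Fin 3 → ℕ} {p : MvPolynomial (Fin 3) K}
    (h : ∀ i, p.degreeOf i < D i) : p ∈ box K D := by
  rw [mem_box]
  intro m hm i
  exact (MvPolynomial.degreeOf_lt_iff (by have := h i; omega)).1 (h i) m hm

lemma degreeOf_of_mem_box {D : Fin 3 → ℕ} {p : MvPolynomial (Fin 3) K}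
    (hp : p ∈ box K D) (h0 : p ≠ 0) (i : Fin 3) : p.degreeOf i < D i := by
  rw [mem_box] at hp
  obtain ⟨m, hm⟩ := MvPolynomial.support_nonempty.2 h0
  have := hp m hm i
  exact (MvPolynomial.degreeOf_lt_iff (by omega)).2 fun m hm => hp m hm i

/-- index equivalence -/
noncomputable def boxEquiv (D : Fin 3 → ℕ) :
    ({n | ∀ i, n i < D i} : Set (Fin 3 →₀ ℕ)) ≃ ((i : Fin 3) → Fin (D i)) where
  toFun n := fun i => ⟨n.1 i, n.2 i⟩
  invFun f := ⟨Finsupp.equivFunOnFinite.symm (fun i => (f i : ℕ)), fun i => by simp⟩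
  left_inv n := by ext i; simp
  right_inv f := by ext i; simp

noncomputable instance boxFin (D : Fin 3 → ℕ) : Module.Finite K (box K D) := by
  have : Finite ({n | ∀ i, n i < D i} : Set (Fin 3 →₀ ℕ)) := Finite.of_equiv _ (boxEquiv D).symm
  exact Module.Finite.of_basis (MvPolynomial.basisRestrictSupport K {n | ∀ i, n i < D i})

lemma finrank_box (D : Fin 3 → ℕ) : Module.finrank K (box K D) = D 0 * D 1 * D 2 := by
  have h := Module.finrank_eq_nat_card_basis
    (MvPolynomial.basisRestrictSupport K {n : Fin 3 →₀ ℕ | ∀ i, n i < D i})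
  have h2 : Nat.card ({n | ∀ i, n i < D i} : Set (Fin 3 →₀ ℕ)) = D 0 * D 1 * D 2 := by
    rw [Nat.card_congr (boxEquiv D)]
    simp [Nat.card_eq_fintype_card, Fin.prod_univ_three]
  rw [← h2, ← h]; rfl

/-- separating linear form -/
noncomputable def sep (q r : K × K × K) : MvPolynomial (Fin 3) K :=
  open Classical in
  if q.1 = r.1 ∧ q.2.1 = r.2.1 then
    MvPolynomial.X 2 - MvPolynomial.C (r.2.2 - r.2.1 * r.1) - MvPolynomial.C (r.1 ^ 2) * MvPolynomial.X 0
  else MvPolynomial.X 1 - MvPolynomial.C r.2.1 + MvPolynomial.C r.1 * MvPolynomial.X 0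

lemma sep_self (q r : K × K × K) : rho r (sep q r) = 0 := by
  unfold sep
  split_ifs
  · simp only [map_sub, map_mul, rho_X2, rho_X0, rho_C]; ring
  · simp only [map_sub, map_add, map_mul, rho_X1, rho_X0, rho_C]; ring

lemma sep_ne (q r : K × K × K) (h : q ≠ r) : rho q (sep q r) ≠ 0 := by
  unfold sep
  split_ifs with h1
  · obtain ⟨h1, h2⟩ := h1
    have h3 : q.2.2 ≠ r.2.2 := fun h3 => h (Prod.ext h1 (Prod.ext h2 h3))
    simp only [map_sub, map_mul, map_pow, rho_X2, rho_X0, rho_C]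
    rw [h1, h2]
    have : (Polynomial.C q.2.2 - Polynomial.C r.2.2 : Polynomial K) ≠ 0 := by
      rw [← Polynomial.C_sub]; exact Polynomial.C_ne_zero.2 (sub_ne_zero.2 h3)
    convert this using 1
    ring
  · simp only [map_sub, map_add, map_mul, rho_X1, rho_X0, rho_C]
    intro h0
    apply h1
    have e0 := congrArg (fun f => Polynomial.coeff f 0) h0
    have e1 := congrArg (fun f => Polynomial.coeff f 1) h0
    simp [Polynomial.coeff_C] at e0 e1
    constructor
    · linear_combination -e1
    · linear_combination e0

lemma sep_degreeOf (q r : K × K × K) (i : Fin 3) : (sep q r).degreeOf i ≤ 1 := by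
  refine (MvPolynomial.degreeOf_le_totalDegree _ i).trans ?_
  unfold sep
  split_ifs
  · refine (MvPolynomial.totalDegree_sub _ _).trans (max_le ?_ ?_)
    · refine (MvPolynomial.totalDegree_sub _ _).trans (max_le ?_ ?_)
      · simp
      · rw [MvPolynomial.totalDegree_C]; omega
    · refine (MvPolynomial.totalDegree_mul _ _).trans ?_
      rw [MvPolynomial.totalDegree_C]; simp
  · refine (MvPolynomial.totalDegree_add _ _).trans (max_le ?_ ?_)
    · refine (MvPolynomial.totalDegree_sub _ _).trans (max_le ?_ ?_) <;> simp
    · refine (MvPolynomial.totalDegree_mul _ _).trans ?_; simp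

open Classical in
/-- isolating polynomial -/
noncomputable def iso (W : Finset (K × K × K)) (q : K × K × K) : MvPolynomial (Fin 3) K :=
  ∏ r ∈ W.erase q, sep q r

lemma iso_other (W : Finset (K × K × K)) (q r : K × K × K) (hr : r ∈ W) (h : r ≠ q) :
    rho r (iso W q) = 0 := by
  classical
  unfold iso
  rw [map_prod]
  exact Finset.prod_eq_zero (Finset.mem_erase.2 ⟨h, hr⟩) (sep_self q r)

lemma iso_self (W : Finset (K × K × K)) (q : K × K × K) : rho q (iso W q) ≠ 0 := by
  classical
  unfold iso
  rw [map_prod]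
  exact Finset.prod_ne_zero_iff.2 fun r hr => sep_ne q r (Finset.ne_of_mem_erase hr).symm

lemma iso_degreeOf (W : Finset (K × K × K)) (q : K × K × K) (i : Fin 3) :
    (iso W q).degreeOf i ≤ W.card := by
  classical
  unfold iso
  refine (MvPolynomial.degreeOf_prod_le _ _ _).trans ?_
  refine (Finset.sum_le_card_nsmul _ _ 1 fun r _ => sep_degreeOf q r i).trans ?_
  simpa using Finset.card_erase_le

end Basic
end DS


namespace DS
section Bez
variable {K : Type} [Field K]

lemma mul_mem_box {D D' : Fin 3 → ℕ} {A F : MvPolynomial (Fin 3) K} (hA : A ∈ box K D)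
    (h : ∀ i, D i + F.degreeOf i ≤ D' i) : A * F ∈ box K D' := by
  by_cases h0 : A = 0
  · rw [h0, zero_mul]; exact zero_mem _
  apply mem_box_of_degreeOf
  intro i
  have h1 := MvPolynomial.degreeOf_mul_le i A F
  have h2 := degreeOf_of_mem_box hA h0 i
  have := h i
  omega

theorem bezout_ineq (F E : MvPolynomial (Fin 3) K) (hF : Irreducible F) (hE : ¬ F ∣ E) (b : ℕ)
    (hb : ∀ i, E.degreeOf i ≤ b) (W : Finset (K × K × K))
    (hW : ∀ q ∈ W, rho q F = 0 ∧ rho q E = 0) (D : ℕ) (hD : ∀ i, b + F.degreeOf i ≤ D)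
    (hn : W.card ≤ D) :
    (D - F.degreeOf 0) * (D - F.degreeOf 1) * (D - F.degreeOf 2) + (D - b) * (D - b) * (D - b)
      + W.card * (D - W.card) ≤ D * D * D +
      (D - b - F.degreeOf 0) * (D - b - F.degreeOf 1) * (D - b - F.degreeOf 2) := by
  classical
  have hF0 : F ≠ 0 := hF.ne_zero
  have hP : Prime F := hF.prime
  set a : Fin 3 → ℕ := fun i => F.degreeOf i with ha
  set n := W.card with hn'
  let B1 := box K (fun i => D - a i)
  let B2 := box K (fun _ => D - b)
  let B3 := box K (fun i => D - b - a i)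
  let B := box K (fun _ => D)
  let T : (W × Fin (D - n) → K) →ₗ[K] MvPolynomial (Fin 3) K :=
    Fintype.linearCombination K
      (fun x : W × Fin (D - n) => MvPolynomial.X 0 ^ (x.2 : ℕ) * iso W x.1.1)
  have hT : ∀ c, T c = ∑ x, c x • (MvPolynomial.X 0 ^ (x.2 : ℕ) * iso W x.1.1) := fun c => rfl
  have hTB : ∀ c, T c ∈ B := by
    intro c
    rw [hT]
    refine Submodule.sum_mem _ fun x _ => Submodule.smul_mem _ _ ?_
    apply mem_box_of_degreeOf
    intro i
    have h1 := MvPolynomial.degreeOf_mul_le i (MvPolynomial.X 0 ^ (x.2 : ℕ)) (iso W x.1.1)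
    have h2 := iso_degreeOf W x.1.1 i
    have h3 : (MvPolynomial.X 0 ^ (x.2 : ℕ) : MvPolynomial (Fin 3) K).degreeOf i ≤ x.2 := by
      refine (MvPolynomial.degreeOf_pow_le _ _ _).trans ?_
      have : (MvPolynomial.X 0 : MvPolynomial (Fin 3) K).degreeOf i ≤ 1 := by
        rw [MvPolynomial.degreeOf_X]; split_ifs <;> simp
      nlinarith
    have h4 := x.2.2
    omega
  -- T injective through rho
  have hTinj : ∀ c, (∀ q ∈ W, rho q (T c) = 0) → c = 0 := by
    intro c hc
    funext ⟨q, j⟩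
    have h := hc q.1 q.2
    rw [hT, map_sum] at h
    have h2 : ∑ x : W × Fin (D - n), rho q.1 (c x • (MvPolynomial.X 0 ^ (x.2 : ℕ) * iso W x.1.1))
        = (∑ j : Fin (D - n), Polynomial.C (c (q, j)) * Polynomial.X ^ (j : ℕ)) * rho q.1 (iso W q.1) := by
      rw [Fintype.sum_prod_type, Finset.sum_eq_single q]
      · rw [Finset.sum_mul]
        refine Finset.sum_congr rfl fun j _ => ?_
        rw [map_smul, map_mul, map_pow, rho_X0, Polynomial.smul_eq_C_mul]; ring
      · intro r _ hr
        refine Finset.sum_eq_zero fun j _ => ?_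
        rw [map_smul, map_mul, iso_other W r.1 q.1 q.2 (fun h => hr (Subtype.ext h.symm))]; simp
      · simp
    rw [h2] at h
    have h3 := (mul_eq_zero.1 h).resolve_right (iso_self W q.1)
    have h4 := congrArg (fun f => Polynomial.coeff f (j : ℕ)) h3
    simp only [Polynomial.finsetSum_coeff, Polynomial.coeff_C_mul, Polynomial.coeff_X_pow,
      Polynomial.coeff_zero] at h4
    rw [Finset.sum_eq_single j] at h4
    · simpa using h4
    · intro i _ hi
      rw [if_neg (fun h => hi (Fin.ext h.symm)), mul_zero]
    · simp
  let Θ0 : (B1 × B2 × (W × Fin (D - n) → K)) →ₗ[K] MvPolynomial (Fin 3) K :=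
    ((LinearMap.mulRight K F).comp B1.subtype).coprod
      (((LinearMap.mulRight K E).comp B2.subtype).coprod T)
  have hΘ0 : ∀ x, Θ0 x = x.1.1 * F + (x.2.1.1 * E + T x.2.2) := fun x => rfl
  have hΘB : ∀ x, Θ0 x ∈ B := by
    intro x
    rw [hΘ0]
    refine add_mem (mul_mem_box x.1.2 fun i => ?_) (add_mem (mul_mem_box x.2.1.2 fun i => ?_) (hTB _))
    · have := hD i; simp only [ha]; omega
    · have := hD i; have := hb i; omega
  let Θ : (B1 × B2 × (W × Fin (D - n) → K)) →ₗ[K] B := Θ0.codRestrict B hΘB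
  let Ψ : B3 →ₗ[K] (B1 × B2 × (W × Fin (D - n) → K)) :=
    LinearMap.prod (((LinearMap.mulRight K (-E)).comp B3.subtype).codRestrict B1 (by
        intro x
        refine mul_mem_box x.2 fun i => ?_
        have := hD i; have := hb i
        simp only [ha, MvPolynomial.degreeOf_neg]; omega))
      (LinearMap.prod (((LinearMap.mulRight K F).comp B3.subtype).codRestrict B2 (by
        intro x
        refine mul_mem_box x.2 fun i => ?_
        have := hD i; simp only [ha]; omega)) 0)
  have hker : LinearMap.ker Θ ≤ LinearMap.range Ψ := by
    rintro ⟨A, C, c⟩ hx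
    have hx0 : (A : MvPolynomial (Fin 3) K) * F + (C.1 * E + T c) = 0 := by
      have := congrArg Subtype.val (LinearMap.mem_ker.1 hx)
      exact this
    have hc : c = 0 := by
      apply hTinj
      intro q hq
      have := congrArg (rho q) hx0
      rw [map_add, map_add, map_mul, map_mul, (hW q hq).1, (hW q hq).2] at this
      simpa using this
    subst hc
    rw [map_zero, add_zero] at hx0
    have hd : F ∣ C.1 * E := ⟨-A.1, by linear_combination hx0⟩
    obtain ⟨G, hG⟩ := (hP.dvd_or_dvd hd).resolve_right hE
    have hGB : G ∈ B3 := by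
      by_cases hG0 : G = 0
      · rw [hG0]; exact zero_mem _
      · apply mem_box_of_degreeOf
        intro i
        have h1 := degreeOf_of_mem_box C.2 (by rw [hG]; exact mul_ne_zero hF0 hG0) i
        rw [hG, MvPolynomial.degreeOf_mul_eq hF0 hG0] at h1
        simp only [ha]; omega
    refine ⟨⟨G, hGB⟩, ?_⟩
    refine Prod.ext ?_ (Prod.ext ?_ rfl)
    · apply Subtype.ext
      change G * (-E) = A.1
      have : F * (G * (-E) - A.1) = 0 := by rw [hG] at hx0; linear_combination -hx0
      exact sub_eq_zero.1 ((mul_eq_zero.1 this).resolve_left hF0)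
    · apply Subtype.ext
      change G * F = C.1
      rw [hG, mul_comm]
  have e1 := LinearMap.finrank_range_add_finrank_ker Θ
  have e2 : Module.finrank K (LinearMap.range Θ) ≤ Module.finrank K B := Submodule.finrank_le _
  have e3 : Module.finrank K (LinearMap.ker Θ) ≤ Module.finrank K (LinearMap.range Ψ) :=
    Submodule.finrank_mono hker
  have e4 : Module.finrank K (LinearMap.range Ψ) ≤ Module.finrank K B3 := LinearMap.finrank_range_le Ψ
  have e5 : Module.finrank K (B1 × B2 × (W × Fin (D - n) → K)) =
      Module.finrank K B1 + (Module.finrank K B2 + n * (D - n)) := by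
    rw [Module.finrank_prod, Module.finrank_prod, Module.finrank_fintype_fun_eq_card]
    simp [n]
  rw [e5, finrank_box, finrank_box] at e1
  rw [finrank_box] at e2 e4
  simp only [ha] at *
  omega

theorem bezout (F E : MvPolynomial (Fin 3) K) (hF : Irreducible F) (hE : ¬ F ∣ E) (d b : ℕ)
    (hd : F.totalDegree ≤ d)
    (hb : E.totalDegree ≤ b) (W : Finset (K × K × K))
    (hW : ∀ q ∈ W, rho q F = 0 ∧ rho q E = 0) : W.card ≤ 6 * d * b := by
  by_contra hcon
  push Not at hcon
  have ha : ∀ i, F.degreeOf i ≤ d := fun i => (MvPolynomial.degreeOf_le_totalDegree _ i).trans hd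
  set n := W.card with hn
  set D := n * n + n + b + d + 1 with hD
  have h := bezout_ineq F E hF hE b (fun i => (MvPolynomial.degreeOf_le_totalDegree _ i).trans hb)
    W hW D (fun i => by have := ha i; omega) (by rw [hD, ← hn]; nlinarith)
  have h0 := ha 0
  have h1 := ha 1
  have h2 := ha 2
  set x := F.degreeOf 0
  set y := F.degreeOf 1
  set z := F.degreeOf 2
  rw [← hn] at h
  obtain ⟨M, hM⟩ : ∃ M, D = M + b + d := ⟨n * n + n + 1, by omega⟩
  have hnD : n ≤ D := by omega
  zify [show x ≤ D by omega, show y ≤ D by omega, show z ≤ D by omega, show b ≤ D by omega,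
    show x ≤ D - b by omega, show y ≤ D - b by omega, show z ≤ D - b by omega, hnD] at h
  zify at hcon h0 h1 h2
  have hDz : (D : ℤ) = n * n + n + b + d + 1 := by rw [hD]; push_cast; ring
  have k1 : (n : ℤ) * (D - n) ≤ 2 * (x + y + z) * b * D := by
    have p1 : (0 : ℤ) ≤ (x + y + z) * b * b := by positivity
    have p2 : (0 : ℤ) ≤ (x * y + y * z + x * z) * b := by positivity
    nlinarith
  have k2 : 2 * ((x : ℤ) + y + z) * b * D ≤ 6 * d * b * D := by
    have : ((x : ℤ) + y + z) ≤ 3 * d := by linarith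
    have hbD : (0 : ℤ) ≤ b * D := by positivity
    nlinarith
  have k3 : ((6 : ℤ) * d * b + 1) * D ≤ n * D := by
    apply mul_le_mul_of_nonneg_right _ (by positivity); linarith
  nlinarith

end Bez
end DS


namespace DS
section Der
variable {K : Type} [Field K]

abbrev MP (K : Type) [Field K] := MvPolynomial (Fin 3) K

noncomputable def dd (a : K) : Derivation K (MP K) (MP K) :=
  MvPolynomial.pderiv 0 - a • MvPolynomial.pderiv 1 + (a ^ 2) • MvPolynomial.pderiv 2
noncomputable def de (a : K) : Derivation K (MP K) (MP K) :=
  MvPolynomial.pderiv 1 - (2 * a) • MvPolynomial.pderiv 2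

lemma dd_apply (a : K) (G : MP K) : dd a G = MvPolynomial.pderiv 0 G
    - MvPolynomial.C a * MvPolynomial.pderiv 1 G + MvPolynomial.C a ^ 2 * MvPolynomial.pderiv 2 G := by
  simp [dd, MvPolynomial.smul_eq_C_mul]

lemma de_apply (a : K) (G : MP K) : de a G = MvPolynomial.pderiv 1 G
    - 2 * MvPolynomial.C a * MvPolynomial.pderiv 2 G := by
  simp [de, MvPolynomial.smul_eq_C_mul, mul_assoc]
  left; rfl

lemma pd_comm (i j : Fin 3) (G : MP K) : MvPolynomial.pderiv i (MvPolynomial.pderiv j G) =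
    MvPolynomial.pderiv j (MvPolynomial.pderiv i G) := by
  ext m
  simp only [MvPolynomial.coeff_pderiv]
  by_cases h : i = j
  · rw [h]
  · rw [add_right_comm]
    simp [h, Ne.symm h]
    ring

lemma rho_derivative (q : K × K × K) (G : MP K) :
    Polynomial.derivative (rho q G) = rho q (dd q.1 G) := by
  induction G using MvPolynomial.induction_on with
  | C x => simp
  | add f g hf hg => simp [hf, hg]
  | mul_X f i hf =>
    rw [map_mul, Polynomial.derivative_mul, hf, Derivation.leibniz, map_add, smul_eq_mul, smul_eq_mul,
      map_mul, map_mul, add_comm, mul_comm (rho q (MvPolynomial.X i))]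
    congr 2
    fin_cases i <;> simp [rho_X0, rho_X1, rho_X2, dd_apply, MvPolynomial.pderiv_X]
    rw [← Polynomial.C_pow, Polynomial.derivative_C]

/-- point of the line -/
def pt (q : K × K × K) (t : K) : Fin 3 → K :=
  ![t, q.2.1 - q.1 * t, q.2.2 - q.2.1 * q.1 + q.1 ^ 2 * t]

lemma rho_eval (q : K × K × K) (t : K) (G : MP K) :
    (rho q G).eval t = MvPolynomial.eval (pt q t) G := by
  induction G using MvPolynomial.induction_on with
  | C x => simp
  | add f g hf hg => simp [hf, hg]
  | mul_X f i hf =>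
    rw [map_mul, Polynomial.eval_mul, hf, map_mul]
    congr 1
    fin_cases i <;> simp [rho_X0, rho_X1, rho_X2, pt]

lemma pderiv_totalDegree (i : Fin 3) (F : MP K) : (MvPolynomial.pderiv i F).totalDegree ≤ F.totalDegree - 1 := by
  apply Finset.sup_le
  intro m hm
  rw [MvPolynomial.mem_support_iff, MvPolynomial.coeff_pderiv] at hm
  have h := MvPolynomial.le_totalDegree (MvPolynomial.mem_support_iff.2 (left_ne_zero_of_mul hm))
  rw [Finsupp.sum_add_index' (by simp) (by simp), Finsupp.sum_single_index rfl] at h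
  omega

lemma not_dvd_pderiv (i : Fin 3) (F : MP K) (h0 : MvPolynomial.pderiv i F ≠ 0) :
    ¬ F ∣ MvPolynomial.pderiv i F := by
  intro h
  have h1 := MvPolynomial.totalDegree_le_of_dvd_of_isDomain h h0
  have h2 := pderiv_totalDegree i F
  have h3 : F.totalDegree = 0 := by omega
  rw [MvPolynomial.totalDegree_eq_zero_iff_eq_C] at h3
  rw [h3] at h0
  simp at h0

lemma exists_pderiv (p : ℕ) [CharP K p] (F : MP K) (hF : Irreducible F) (hd : F.totalDegree < p)
    (h0 : ∀ i, MvPolynomial.pderiv i F = 0) : False := by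
  have hF0 : F.totalDegree ≠ 0 := by
    intro h3
    rw [MvPolynomial.totalDegree_eq_zero_iff_eq_C] at h3
    have h4 : MvPolynomial.coeff 0 F ≠ 0 := by
      intro h; rw [h] at h3; exact hF.ne_zero (by simpa using h3)
    apply hF.not_isUnit
    rw [h3]
    exact (isUnit_iff_ne_zero.2 h4).map MvPolynomial.C
  apply hF0
  apply Nat.eq_zero_of_le_zero
  apply Finset.sup_le
  intro m hm
  by_contra hcon
  have : ∃ i, m i ≠ 0 := by
    by_contra hh
    push Not at hh
    apply hcon
    have : m = 0 := by ext i; simp [hh i]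
    simp [this]
  obtain ⟨i, hi⟩ := this
  have h1 := congrArg (MvPolynomial.coeff (m - Finsupp.single i 1)) (h0 i)
  rw [MvPolynomial.coeff_pderiv, tsub_add_cancel_of_le (by
    rw [Finsupp.single_le_iff]; omega), MvPolynomial.coeff_zero] at h1
  have h2 := (mul_eq_zero.1 h1).resolve_left (MvPolynomial.mem_support_iff.1 hm)
  have h3 : ((m i : ℕ) : K) = 0 := by
    rw [← h2]
    simp only [Finsupp.tsub_apply, Finsupp.single_eq_same]
    rw [← Nat.cast_add_one]
    congr 1; omega
  rw [CharP.cast_eq_zero_iff K p] at h3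
  have h4 : m i ≤ F.totalDegree := by
    refine le_trans ?_ (MvPolynomial.le_totalDegree hm)
    rw [Finsupp.sum_fintype _ _ (by simp)]
    exact Finset.single_le_sum (f := fun i => m i) (by simp) (Finset.mem_univ i)
  have := Nat.le_of_dvd (by omega) h3
  omega

/-- Wronskian lemma in characteristic `p`, low degree. -/
lemma wronsk (p : ℕ) [CharP K p] (Q : Polynomial K) (hQ : Q ≠ 0) (hQd : Q.natDegree < p) :
    ∀ (n : ℕ) (P : Polynomial K), P.natDegree ≤ n → P.natDegree < p →
    Polynomial.derivative P * Q = P * Polynomial.derivative Q → ∃ c : K, P = Polynomial.C c * Q := by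
  have key : ∀ (P : Polynomial K), P.natDegree < p →
    Polynomial.derivative P * Q = P * Polynomial.derivative Q → P.natDegree ≠ Q.natDegree → P = 0 := by
    intro P hPd h hne
    by_contra hP
    by_cases hz : P.natDegree + Q.natDegree = 0
    · omega
    have e := congrArg (fun f => Polynomial.coeff f (P.natDegree + Q.natDegree - 1)) h
    have gen : ∀ A B : Polynomial K, A.natDegree + B.natDegree ≠ 0 → 
       (Polynomial.derivative A * B).coeff (A.natDegree + B.natDegree - 1) =
        A.natDegree * (A.leadingCoeff * B.leadingCoeff) := by
      intro A B hAB
      by_cases hA : A.natDegree = 0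
      · rw [hA, Polynomial.derivative_of_natDegree_zero hA]; simp
      · have : A.natDegree + B.natDegree - 1 = (A.natDegree - 1) + B.natDegree := by omega
        rw [this, Polynomial.coeff_mul_add_eq_of_natDegree_le (Polynomial.natDegree_derivative_le A) le_rfl,
          Polynomial.coeff_derivative, ← Nat.cast_add_one, Nat.sub_add_cancel (by omega)]
        simp only [Polynomial.leadingCoeff]; ring
    beta_reduce at e
    rw [gen P Q hz, mul_comm P, add_comm P.natDegree, gen Q P (by omega)] at e
    have e2 : ((P.natDegree : K) - Q.natDegree) * (P.leadingCoeff * Q.leadingCoeff) = 0 := by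
      linear_combination e
    have e3 := (mul_eq_zero.1 e2).resolve_right
      (mul_ne_zero (Polynomial.leadingCoeff_ne_zero.2 hP) (Polynomial.leadingCoeff_ne_zero.2 hQ))
    rw [sub_eq_zero] at e3
    have e4 := (CharP.natCast_eq_natCast K p).1 e3
    exact hne (Nat.ModEq.eq_of_lt_of_lt e4 hPd hQd)
  intro _ P _ hPd h
  by_cases hd : P.natDegree = Q.natDegree
  · refine ⟨P.leadingCoeff / Q.leadingCoeff, ?_⟩
    set c := P.leadingCoeff / Q.leadingCoeff with hc
    have hlq := Polynomial.leadingCoeff_ne_zero.2 hQ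
    by_cases hQ0 : Q.natDegree = 0
    · rw [Polynomial.eq_C_of_natDegree_eq_zero hQ0, Polynomial.eq_C_of_natDegree_eq_zero (hd.trans hQ0)]
      rw [← Polynomial.C_mul, hc]
      simp only [Polynomial.leadingCoeff, hd, hQ0] at hlq ⊢
      rw [div_mul_cancel₀ _ hlq]
    have hlt : (P - Polynomial.C c * Q).natDegree < Q.natDegree := by
      have hle : (P - Polynomial.C c * Q).natDegree ≤ Q.natDegree :=
        (Polynomial.natDegree_sub_le _ _).trans (max_le hd.le (Polynomial.natDegree_C_mul_le _ _))
      have hcz : (P - Polynomial.C c * Q).coeff Q.natDegree = 0 := by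
        rw [Polynomial.coeff_sub, Polynomial.coeff_C_mul]
        have : P.coeff Q.natDegree = P.leadingCoeff := by rw [← hd]; rfl
        rw [this, Polynomial.coeff_natDegree, hc, div_mul_cancel₀ _ hlq, sub_self]
      refine lt_of_le_of_ne hle fun heq => ?_
      rw [← heq] at hcz
      have := Polynomial.leadingCoeff_eq_zero.1 hcz
      rw [this] at heq
      simp at heq
      omega
    refine sub_eq_zero.1 (key _ (by omega) ?_ hlt.ne)
    simp only [Polynomial.derivative_sub, Polynomial.derivative_C_mul]
    linear_combination h
  · exact ⟨0, by rw [key P hPd h hd]; simp⟩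

end Der
end DS


namespace DS
set_option linter.unusedSimpArgs false
section Forms
variable {R : Type} [CommRing R]
def Th (v w vv vw ww : R) : R := vv * w ^ 2 - 2 * vw * v * w + ww * v ^ 2
def Ps (u v w uv uw vw ww : R) : R := uv * w ^ 2 - uw * v * w - vw * u * w + ww * u * v
def Om (u w uu uw ww : R) : R := uu * w ^ 2 - 2 * uw * u * w + ww * u ^ 2
end Forms

section Flec
variable {K : Type} [Field K]
open MvPolynomial (pderiv)

noncomputable def ThP (F : MP K) : MP K := Th (pderiv 1 F) (pderiv 2 F) (pderiv 1 (pderiv 1 F))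
  (pderiv 1 (pderiv 2 F)) (pderiv 2 (pderiv 2 F))
noncomputable def PsP (F : MP K) : MP K := Ps (pderiv 0 F) (pderiv 1 F) (pderiv 2 F)
  (pderiv 0 (pderiv 1 F)) (pderiv 0 (pderiv 2 F)) (pderiv 1 (pderiv 2 F)) (pderiv 2 (pderiv 2 F))
noncomputable def OmP (F : MP K) : MP K := Om (pderiv 0 F) (pderiv 2 F)
  (pderiv 0 (pderiv 0 F)) (pderiv 0 (pderiv 2 F)) (pderiv 2 (pderiv 2 F))
noncomputable def E1P (F : MP K) : MP K := 2 * pderiv 2 F * PsP F - pderiv 1 F * ThP F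
noncomputable def E2P (F : MP K) : MP K := pderiv 2 F * OmP F - pderiv 0 F * ThP F

/-- hatted versions -/
lemma E1_hat (a : K) (F : MP K) : E1P F =
    2 * pderiv 2 F * Ps (dd a F) (de a F) (pderiv 2 F) (dd a (de a F)) (dd a (pderiv 2 F))
      (de a (pderiv 2 F)) (pderiv 2 (pderiv 2 F)) -
    de a F * Th (de a F) (pderiv 2 F) (de a (de a F)) (de a (pderiv 2 F)) (pderiv 2 (pderiv 2 F)) := by
  simp only [E1P, PsP, ThP, Ps, Th, dd_apply, de_apply, map_sub, map_add, MvPolynomial.pderiv_mul,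
    MvPolynomial.pderiv_C, pd_comm 2 1, pd_comm 2 0, pd_comm 1 0, MvPolynomial.pderiv_pow, Derivation.map_natCast]
  have h2 : ∀ i, pderiv i (2 : MP K) = 0 := fun i => by
    have := Derivation.map_natCast (pderiv (R := K) i) 2; simpa using this
  simp only [h2]
  ring

lemma E2_hat (a : K) (F : MP K) : E2P F - MvPolynomial.C a * E1P F =
    pderiv 2 F * Om (dd a F) (pderiv 2 F) (dd a (dd a F)) (dd a (pderiv 2 F)) (pderiv 2 (pderiv 2 F)) -
    dd a F * Th (de a F) (pderiv 2 F) (de a (de a F)) (de a (pderiv 2 F)) (pderiv 2 (pderiv 2 F)) := by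
  simp only [E1P, E2P, PsP, ThP, OmP, Om, Ps, Th, dd_apply, de_apply, map_sub, map_add, MvPolynomial.pderiv_mul,
    MvPolynomial.pderiv_C, pd_comm 2 1, pd_comm 2 0, pd_comm 1 0, MvPolynomial.pderiv_pow, Derivation.map_natCast]
  have h2 : ∀ i, pderiv i (2 : MP K) = 0 := fun i => by
    have := Derivation.map_natCast (pderiv (R := K) i) 2; simpa using this
  simp only [h2]
  ring

lemma de_dd (a : K) (G : MP K) : de a (dd a G) = dd a (de a G) := by
  have h2 : ∀ i, pderiv i (2 : MP K) = 0 := fun i => by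
    have := Derivation.map_natCast (pderiv (R := K) i) 2; simpa using this
  simp only [dd_apply, de_apply, map_sub, map_add, MvPolynomial.pderiv_mul,
    MvPolynomial.pderiv_C, pd_comm 2 1, pd_comm 2 0, pd_comm 1 0, MvPolynomial.pderiv_pow, h2]
  ring

lemma dw_dd (a : K) (G : MP K) : pderiv 2 (dd a G) = dd a (pderiv 2 G) := by
  simp only [dd_apply, de_apply, map_sub, map_add, MvPolynomial.pderiv_mul,
    MvPolynomial.pderiv_C, pd_comm 2 1, pd_comm 2 0, pd_comm 1 0, MvPolynomial.pderiv_pow]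
  ring

noncomputable def Yd (F : MP K) : Derivation K (MP K) (MP K) :=
  pderiv 2 F • pderiv 1 - pderiv 1 F • pderiv 2

lemma Yd_apply (a : K) (F G : MP K) : Yd F G = pderiv 2 F * de a G - de a F * pderiv 2 G := by
  simp only [Yd, Derivation.coe_sub, Derivation.coe_smul, Pi.sub_apply, Pi.smul_apply, smul_eq_mul,
    de_apply]
  ring

lemma Yd_self (F : MP K) : Yd F F = 0 := by
  simp only [Yd, Derivation.coe_sub, Derivation.coe_smul, Pi.sub_apply, Pi.smul_apply, smul_eq_mul]
  ring

lemma ode (p : ℕ) [CharP K p] (F : MP K) (d : ℕ) (hd : F.totalDegree ≤ d) (hdp : 2 * d < p)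
    (q : K × K × K) (hq : rho q F = 0) (hE1 : F ∣ E1P F) (hE2 : F ∣ E2P F)
    (hn : rho q (pderiv 2 F) ≠ 0) (hv : rho q (de q.1 F) ≠ 0) :
    ∃ c0 c1 : K, rho q (pderiv 2 F) =
      (Polynomial.C c0 + Polynomial.C c1 * Polynomial.X) * rho q (de q.1 F) := by
  set a := q.1 with ha
  set n := rho q (pderiv 2 F) with hn'
  set v := rho q (de a F) with hv'
  set u := dd a F with hu'
  set th := Th (de a F) (pderiv 2 F) (de a (de a F)) (de a (pderiv 2 F)) (pderiv 2 (pderiv 2 F)) with hth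
  have hu : rho q u = 0 := by rw [hu', ← rho_derivative, hq]; simp
  have huu : rho q (dd a u) = 0 := by rw [← rho_derivative, hu]; simp
  have hn1 : rho q (dd a (pderiv 2 F)) = Polynomial.derivative n := by rw [hn', rho_derivative]
  have hv1 : rho q (dd a (de a F)) = Polynomial.derivative v := by rw [hv', rho_derivative]
  have hYu : rho q (Yd F u) = n * Polynomial.derivative v - v * Polynomial.derivative n := by
    rw [Yd_apply a, de_dd, dw_dd, map_sub, map_mul, map_mul, hn1, hv1]
  have hYuu : rho q (Yd F (dd a u)) = n * Polynomial.derivative (Polynomial.derivative v)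
      - v * Polynomial.derivative (Polynomial.derivative n) := by
    rw [Yd_apply a, de_dd, dw_dd, de_dd, dw_dd, map_sub, map_mul, map_mul, ← hn1, ← hv1,
      rho_derivative, rho_derivative]
  have e1 : -2 * n ^ 2 * (Polynomial.derivative n * v - n * Polynomial.derivative v) = v * rho q th := by
    obtain ⟨H, hH⟩ := hE1
    rw [E1_hat a] at hH
    have := congrArg (rho q) hH
    rw [← hth] at this
    simp only [Ps, map_sub, map_add, map_mul, map_pow, hq, ← hu', hu, hn1, hv1, ← hn', ← hv', map_ofNat] at this
    linear_combination this
  have e2 : n * (n ^ 2 * rho q (Yd F (dd a u)) - 2 * Polynomial.derivative n * n * rho q (Yd F u))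
      - rho q (Yd F u) * rho q th = 0 := by
    have hdv : F ∣ E2P F - MvPolynomial.C a * E1P F := dvd_sub hE2 (Dvd.dvd.mul_left hE1 _)
    obtain ⟨H, hH⟩ := hdv
    rw [E2_hat a] at hH
    have := congrArg (fun G => rho q (Yd F G)) hH
    rw [← hth] at this
    have h2 : Yd F (2 : MP K) = 0 := by
      have := Derivation.map_natCast (Yd F) 2; simpa using this
    simp only [Om, map_sub, map_add, Derivation.leibniz, Derivation.leibniz_pow, smul_eq_mul, map_mul, map_pow, hq,
      Yd_self, ← hu', hu, huu, hn1, hv1, ← hn', ← hv', map_ofNat, h2, map_zero, nsmul_eq_mul] at this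
    simp only [mul_zero, zero_mul, add_zero, zero_add, sub_zero, ne_eq, OfNat.ofNat_ne_zero, not_false_eq_true, zero_pow] at this
    linear_combination this
  set n1 := Polynomial.derivative n with hn1'
  set v1 := Polynomial.derivative v with hv1'
  rw [hYu, hYuu] at e2
  set Wr := n1 * v - n * v1 with hWr
  have hWr1 : Polynomial.derivative Wr = Polynomial.derivative n1 * v - n * Polynomial.derivative v1 := by
    rw [hWr]; simp only [Polynomial.derivative_sub, Polynomial.derivative_mul, ← hn1', ← hv1']; ring
  have e3 : v * Polynomial.derivative Wr = 2 * Wr * v1 := by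
    have : n ^ 3 * (v * Polynomial.derivative Wr - 2 * Wr * v1) = 0 := by
      rw [hWr1]
      linear_combination -v * e2 - Wr * e1
    exact sub_eq_zero.1 ((mul_eq_zero.1 this).resolve_left (pow_ne_zero _ hn))
  have hnd : n.natDegree ≤ d - 1 := (rho_natDegree _ _).trans ((pderiv_totalDegree _ _).trans (by omega))
  have hvd : v.natDegree ≤ d - 1 := by
    refine (rho_natDegree _ _).trans ?_
    rw [de_apply]
    refine (MvPolynomial.totalDegree_sub _ _).trans (max_le ?_ ?_)
    · exact (pderiv_totalDegree _ _).trans (by omega)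
    · refine (MvPolynomial.totalDegree_mul _ _).trans ?_
      have := pderiv_totalDegree 2 F
      have h2 : (2 * MvPolynomial.C a : MP K).totalDegree = 0 := by
        have h3 := MvPolynomial.totalDegree_C (2 * a) (σ := Fin 3)
        rwa [MvPolynomial.C_mul, map_ofNat] at h3
      omega
  have hn1d : n1.natDegree ≤ d - 1 := (Polynomial.natDegree_derivative_le _).trans (by omega)
  have hv1d : v1.natDegree ≤ d - 1 := (Polynomial.natDegree_derivative_le _).trans (by omega)
  by_cases hd0 : d = 0
  · exfalso
    have h3 : F.totalDegree = 0 := by omega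
    rw [MvPolynomial.totalDegree_eq_zero_iff_eq_C] at h3
    apply hn
    rw [hn', h3]; simp
  obtain ⟨c1, hc1⟩ := wronsk p (v ^ 2) (pow_ne_zero _ hv)
    (lt_of_le_of_lt (Polynomial.natDegree_pow_le) (by omega)) _ Wr le_rfl
    (by
      refine lt_of_le_of_lt (Polynomial.natDegree_sub_le _ _) (max_lt ?_ ?_)
      · exact lt_of_le_of_lt Polynomial.natDegree_mul_le (by omega)
      · exact lt_of_le_of_lt Polynomial.natDegree_mul_le (by omega)) (by
      rw [pow_two, Polynomial.derivative_mul, ← hv1']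
      linear_combination v * e3)
  obtain ⟨c0, hc0⟩ := wronsk p v hv (by omega) _ (n - Polynomial.C c1 * Polynomial.X * v) le_rfl
    (by
      refine lt_of_le_of_lt (Polynomial.natDegree_sub_le _ _) (max_lt (by omega) ?_)
      refine lt_of_le_of_lt Polynomial.natDegree_mul_le ?_
      have : (Polynomial.C c1 * Polynomial.X).natDegree ≤ 1 := by compute_degree
      omega) (by
      simp only [Polynomial.derivative_sub, Polynomial.derivative_mul, Polynomial.derivative_C,
        Polynomial.derivative_X, ← hn1', ← hv1']
      linear_combination hc1)
  exact ⟨c0, c1, by linear_combination hc0⟩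

end Flec
end DS


namespace DS
set_option linter.unusedSimpArgs false
section Irr
variable {K : Type} [Field K]
open MvPolynomial (pderiv)

def meets (q r : K × K × K) : Prop :=
  q.1 ≠ r.1 ∧ q.2.2 - r.2.2 + q.2.1 * r.1 - r.2.1 * q.1 = 0
def tt (q r : K × K × K) : K := (q.2.1 - r.2.1) / (q.1 - r.1)

lemma tt_symm (q r : K × K × K) : tt q r = tt r q := by
  unfold tt
  rw [← neg_sub r.2.1, ← neg_sub r.1, neg_div_neg_eq]

lemma tt_mul {q r : K × K × K} (h : meets q r) : tt q r * (q.1 - r.1) = q.2.1 - r.2.1 := by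
  unfold tt
  exact div_mul_cancel₀ _ (sub_ne_zero.2 h.1)

lemma pt_eq {q r : K × K × K} (h : meets q r) : pt q (tt q r) = pt r (tt q r) := by
  have h1 := tt_mul h
  have h2 := h.2
  unfold pt
  have e1 : q.2.1 - q.1 * tt q r = r.2.1 - r.1 * tt q r := by linear_combination -h1
  have e2 : q.2.2 - q.2.1 * q.1 + q.1 ^ 2 * tt q r = r.2.2 - r.2.1 * r.1 + r.1 ^ 2 * tt q r := by
    linear_combination h2 + (q.1 + r.1) * h1
  rw [e1, e2]

structure Gthree (κ : ℕ) (W : Finset (K × K × K)) : Prop where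
  aff : ∀ α β γ ε : K, ∀ T ⊆ W, (∀ r ∈ T, r.2.1 = α + β * r.1 ∧ r.2.2 = γ + ε * r.1) → T.card ≤ κ
  vert : ∀ a0 g h : K, ∀ T ⊆ W, (∀ r ∈ T, r.1 = a0 ∧ r.2.2 + g * r.2.1 = h) → T.card ≤ κ

lemma Gthree.mono {κ : ℕ} {W W' : Finset (K × K × K)} (h : Gthree κ W) (hs : W' ⊆ W) : Gthree κ W' :=
  ⟨fun a b c e T hT => h.aff a b c e T (hT.trans hs), fun a b c T hT => h.vert a b c T (hT.trans hs)⟩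

lemma card_roots_le (q : K × K × K) (T : Finset (K × K × K)) (hT : Set.InjOn (tt q) T)
    (P : Polynomial K) (hP : P ≠ 0) (h : ∀ r ∈ T, P.eval (tt q r) = 0) : T.card ≤ P.natDegree := by
  classical
  rw [← Finset.card_image_of_injOn hT]
  apply Polynomial.card_le_degree_of_subset_roots
  intro x hx
  rw [Finset.mem_val, Finset.mem_image] at hx
  obtain ⟨r, hr, rfl⟩ := hx
  rw [Polynomial.mem_roots hP]
  exact h r hr

lemma dg_mul {a b : ℕ} {F G : MP K} (h1 : F.totalDegree ≤ a) (h2 : G.totalDegree ≤ b) :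
    (F * G).totalDegree ≤ a + b := (MvPolynomial.totalDegree_mul _ _).trans (add_le_add h1 h2)
lemma dg_add {a : ℕ} {F G : MP K} (h1 : F.totalDegree ≤ a) (h2 : G.totalDegree ≤ a) :
    (F + G).totalDegree ≤ a := (MvPolynomial.totalDegree_add _ _).trans (max_le h1 h2)
lemma dg_sub {a : ℕ} {F G : MP K} (h1 : F.totalDegree ≤ a) (h2 : G.totalDegree ≤ a) :
    (F - G).totalDegree ≤ a := (MvPolynomial.totalDegree_sub _ _).trans (max_le h1 h2)
lemma dg_pow {a : ℕ} (n : ℕ) {F : MP K} (h1 : F.totalDegree ≤ a) :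
    (F ^ n).totalDegree ≤ n * a := (MvPolynomial.totalDegree_pow _ _).trans (Nat.mul_le_mul_left _ h1)
lemma dg_two : (2 : MP K).totalDegree ≤ 0 := by
  have h3 := MvPolynomial.totalDegree_C (2 : K) (σ := Fin 3)
  rw [map_ofNat] at h3
  exact h3.le
lemma dg_pd {a : ℕ} (i : Fin 3) {F : MP K} (h1 : F.totalDegree ≤ a) :
    (pderiv i F).totalDegree ≤ a := (pderiv_totalDegree i F).trans (by omega)

lemma dg_Th {d : ℕ} {F : MP K} (h : F.totalDegree ≤ d) : (ThP F).totalDegree ≤ 3 * d := by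
  unfold ThP Th
  refine dg_add (dg_sub ?_ ?_) ?_
  · exact (dg_mul (dg_pd _ (dg_pd _ h)) (dg_pow 2 (dg_pd _ h))).trans (by omega)
  · exact (dg_mul (dg_mul (dg_mul dg_two (dg_pd _ (dg_pd _ h))) (dg_pd _ h)) (dg_pd _ h)).trans (by omega)
  · exact (dg_mul (dg_pd _ (dg_pd _ h)) (dg_pow 2 (dg_pd _ h))).trans (by omega)

lemma dg_Om {d : ℕ} {F : MP K} (h : F.totalDegree ≤ d) : (OmP F).totalDegree ≤ 3 * d := by
  unfold OmP Om
  refine dg_add (dg_sub ?_ ?_) ?_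
  · exact (dg_mul (dg_pd _ (dg_pd _ h)) (dg_pow 2 (dg_pd _ h))).trans (by omega)
  · exact (dg_mul (dg_mul (dg_mul dg_two (dg_pd _ (dg_pd _ h))) (dg_pd _ h)) (dg_pd _ h)).trans (by omega)
  · exact (dg_mul (dg_pd _ (dg_pd _ h)) (dg_pow 2 (dg_pd _ h))).trans (by omega)

lemma dg_Ps {d : ℕ} {F : MP K} (h : F.totalDegree ≤ d) : (PsP F).totalDegree ≤ 3 * d := by
  unfold PsP Ps
  refine dg_add (dg_sub (dg_sub ?_ ?_) ?_) ?_
  · exact (dg_mul (dg_pd _ (dg_pd _ h)) (dg_pow 2 (dg_pd _ h))).trans (by omega)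
  all_goals
  · exact (dg_mul (dg_mul (dg_pd _ (dg_pd _ h)) (dg_pd _ h)) (dg_pd _ h)).trans (by omega)

lemma dg_E1 {d : ℕ} {F : MP K} (h : F.totalDegree ≤ d) : (E1P F).totalDegree ≤ 4 * d := by
  unfold E1P
  refine dg_sub ?_ ?_
  · exact (dg_mul (dg_mul dg_two (dg_pd _ h)) (dg_Ps h)).trans (by omega)
  · exact (dg_mul (dg_pd _ h) (dg_Th h)).trans (by omega)

lemma dg_E2 {d : ℕ} {F : MP K} (h : F.totalDegree ≤ d) : (E2P F).totalDegree ≤ 4 * d := by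
  unfold E2P
  refine dg_sub ?_ ?_
  · exact (dg_mul (dg_pd _ h) (dg_Om h)).trans (by omega)
  · exact (dg_mul (dg_pd _ h) (dg_Th h)).trans (by omega)

/-- the quintic form along direction `a` -/
noncomputable def QP (a : K) (F : MP K) : MP K :=
  pderiv 2 F ^ 2 * OmP F - 2 * pderiv 2 F * (pderiv 1 F - MvPolynomial.C a * pderiv 2 F) * PsP F
    + (pderiv 1 F - MvPolynomial.C a * pderiv 2 F) ^ 2 * ThP F

lemma dg_Q {d : ℕ} {F : MP K} (a : K) (h : F.totalDegree ≤ d) : (QP a F).totalDegree ≤ 5 * d := by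
  unfold QP
  have h1 : (pderiv 1 F - MvPolynomial.C a * pderiv 2 F).totalDegree ≤ d := by
    refine dg_sub (dg_pd _ h) ?_
    exact (dg_mul (MvPolynomial.totalDegree_C _).le (dg_pd _ h)).trans (by omega)
  refine dg_add (dg_sub ?_ ?_) ?_
  · exact (dg_mul (dg_pow 2 (dg_pd _ h)) (dg_Om h)).trans (by omega)
  · exact (dg_mul (dg_mul (dg_mul dg_two (dg_pd _ h)) h1) (dg_Ps h)).trans (by omega)
  · exact (dg_mul (dg_pow 2 h1) (dg_Th h)).trans (by omega)

/-- first-order relation on a contained line -/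
lemma line1 {F : MP K} {q : K × K × K} (h : rho q F = 0) :
    rho q (pderiv 0 F) - Polynomial.C q.1 * rho q (pderiv 1 F)
      + Polynomial.C q.1 ^ 2 * rho q (pderiv 2 F) = 0 := by
  have := rho_derivative q F
  rw [h, dd_apply] at this
  simpa [rho_C] using this.symm

/-- second-order relation on a contained line -/
lemma line2 {F : MP K} {q : K × K × K} (h : rho q F = 0) :
    rho q (OmP F) - 2 * Polynomial.C q.1 * rho q (PsP F) + Polynomial.C q.1 ^ 2 * rho q (ThP F) = 0 := by
  have h1 := line1 h
  have h2 : rho q (dd q.1 (dd q.1 F)) = 0 := by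
    rw [← rho_derivative, ← rho_derivative, h]; simp
  have hC : ∀ x : K, rho q (MvPolynomial.C x) = Polynomial.C x := rho_C q
  simp only [dd_apply, map_sub, map_add, MvPolynomial.pderiv_mul, map_mul, map_pow, hC,
    MvPolynomial.pderiv_C, pd_comm 2 1, pd_comm 2 0, pd_comm 1 0, MvPolynomial.pderiv_pow, map_zero] at h2
  simp only [OmP, PsP, ThP, Om, Ps, Th, map_sub, map_add, map_mul, map_pow, map_ofNat]
  generalize rho q (pderiv 0 F) = u at *
  generalize rho q (pderiv 1 F) = v at *
  generalize rho q (pderiv 2 F) = w at *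
  generalize rho q (pderiv 0 (pderiv 0 F)) = uu at *
  generalize rho q (pderiv 0 (pderiv 1 F)) = uv at *
  generalize rho q (pderiv 0 (pderiv 2 F)) = uw at *
  generalize rho q (pderiv 1 (pderiv 1 F)) = vv at *
  generalize rho q (pderiv 1 (pderiv 2 F)) = vw at *
  generalize rho q (pderiv 2 (pderiv 2 F)) = ww at *
  generalize Polynomial.C q.1 = a at *
  have hu : u = a * v - a ^ 2 * w := by linear_combination h1
  subst hu
  linear_combination w ^ 2 * h2

lemma nb1 {F : MP K} {q r : K × K × K} (hq : rho q F = 0) (hr : rho r F = 0) (h : meets q r) :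
    (rho q (pderiv 1 F)).eval (tt q r) = (q.1 + r.1) * (rho q (pderiv 2 F)).eval (tt q r) := by
  have h1 := congrArg (Polynomial.eval (tt q r)) (line1 hq)
  have h2 := congrArg (Polynomial.eval (tt q r)) (line1 hr)
  simp only [Polynomial.eval_add, Polynomial.eval_sub, Polynomial.eval_mul, Polynomial.eval_C,
    Polynomial.eval_pow, Polynomial.eval_zero, rho_eval] at h1 h2 ⊢
  rw [← pt_eq h] at h2
  have h3 : (q.1 - r.1) ≠ 0 := sub_ne_zero.2 h.1
  apply mul_left_cancel₀ h3
  linear_combination h2 - h1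

lemma nbQ {F : MP K} {q r : K × K × K} (hq : rho q F = 0) (hr : rho r F = 0) (h : meets q r) :
    (rho q (QP q.1 F)).eval (tt q r) = 0 := by
  have h1 := nb1 hq hr h
  have h2 := congrArg (Polynomial.eval (tt q r)) (line2 hr)
  simp only [QP, map_sub, map_add, map_mul, map_pow, rho_C, map_ofNat]
  simp only [Polynomial.eval_add, Polynomial.eval_sub, Polynomial.eval_mul, Polynomial.eval_C,
    Polynomial.eval_pow, Polynomial.eval_zero, rho_eval, Polynomial.eval_ofNat] at h1 h2 ⊢
  rw [← pt_eq h] at h2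
  rw [h1]
  linear_combination (MvPolynomial.eval (pt q (tt q r)) (pderiv 2 F)) ^ 2 * h2

lemma flecE {F : MP K} {q : K × K × K} (hq : rho q F = 0) (hQ : rho q (QP q.1 F) = 0)
    (hv : rho q (de q.1 F) ≠ 0) : rho q (E1P F) = 0 ∧ rho q (E2P F) = 0 := by
  have h1 := line1 hq
  have h2 := line2 hq
  simp only [QP, map_sub, map_add, map_mul, map_pow, rho_C, map_ofNat] at hQ
  simp only [de_apply, map_sub, map_mul, map_ofNat, rho_C] at hv
  simp only [E1P, E2P, map_sub, map_mul, map_ofNat]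
  generalize rho q (pderiv 0 F) = u at *
  generalize rho q (pderiv 1 F) = v at *
  generalize rho q (pderiv 2 F) = w at *
  generalize rho q (ThP F) = th at *
  generalize rho q (PsP F) = ps at *
  generalize rho q (OmP F) = om at *
  generalize Polynomial.C q.1 = a at *
  have e1 : 2 * w * ps - v * th = 0 := by
    apply (mul_eq_zero.1 (?_ : (v - 2 * a * w) * (2 * w * ps - v * th) = 0)).resolve_left hv
    linear_combination w ^ 2 * h2 - hQ
  refine ⟨e1, ?_⟩
  linear_combination w * h2 - th * h1 + a * e1

/-- ruled case -/
lemma ruled {F : MP K} {d κ : ℕ} (hd : F.totalDegree ≤ d) {q : K × K × K} (hq : rho q F = 0)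
    (hv : rho q (de q.1 F) ≠ 0) (c0 c1 : K)
    (hc : rho q (pderiv 2 F) = (Polynomial.C c0 + Polynomial.C c1 * Polynomial.X) * rho q (de q.1 F))
    {W : Finset (K × K × K)} (hG : Gthree κ W) (hW : ∀ r ∈ W, rho r F = 0)
    (T : Finset (K × K × K)) (hT : T ⊆ W) (hm : ∀ r ∈ T, meets q r) (hi : Set.InjOn (tt q) T) :
    T.card ≤ d + κ := by
  classical
  rw [← Finset.card_filter_add_card_filter_not (s := T) (fun r => (rho q (de q.1 F)).eval (tt q r) = 0)]
  refine add_le_add ?_ ?_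
  · refine (card_roots_le q _ (hi.mono (Finset.coe_subset.2 (Finset.filter_subset _ _))) _ hv (fun r hr => (Finset.mem_filter.1 hr).2)).trans ?_
    refine (rho_natDegree _ _).trans ?_
    rw [de_apply]
    exact dg_sub (dg_pd _ hd) ((dg_mul (dg_mul dg_two (MvPolynomial.totalDegree_C _).le) (dg_pd _ hd)).trans (by omega))
  · have key : ∀ r ∈ T.filter (fun r => ¬ (rho q (de q.1 F)).eval (tt q r) = 0),
        c0 * (r.1 - q.1) + c1 * (r.2.1 - q.2.1) = 1 := by
      intro r hr
      obtain ⟨hr, hne⟩ := Finset.mem_filter.1 hr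
      have h1 := nb1 hq (hW r (hT hr)) (hm r hr)
      have h2 := tt_mul (hm r hr)
      have h3 := congrArg (Polynomial.eval (tt q r)) hc
      rw [de_apply] at hne h3
      simp only [map_sub, map_mul, map_ofNat, rho_C, Polynomial.eval_add, Polynomial.eval_sub, Polynomial.eval_mul, Polynomial.eval_C, Polynomial.eval_X, Polynomial.eval_ofNat] at h3 hne
      rw [h1] at h3 hne
      set N := (rho q (pderiv 2 F)).eval (tt q r)
      have hN : N ≠ 0 := by
        rintro h; rw [h] at hne; apply hne; ring
      apply mul_left_cancel₀ hN
      have h4 : c1 * (r.2.1 - q.2.1) = c1 * (tt q r * (r.1 - q.1)) := by linear_combination c1 * h2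
      rw [h4]
      linear_combination -h3
    have hsub : T.filter (fun r => ¬ (rho q (de q.1 F)).eval (tt q r) = 0) ⊆ W :=
      (Finset.filter_subset _ _).trans hT
    by_cases hc1 : c1 = 0
    · have hc0 : ∀ r ∈ T.filter (fun r => ¬ (rho q (de q.1 F)).eval (tt q r) = 0),
        r.1 = q.1 + 1 / c0 := by
        intro r hr
        have := key r hr
        rw [hc1, zero_mul, add_zero] at this
        have h0 : c0 ≠ 0 := left_ne_zero_of_mul (this ▸ one_ne_zero)
        field_simp
        linear_combination this
      refine hG.vert (q.1 + 1 / c0) q.1 (q.2.2 + q.2.1 * (q.1 + 1 / c0)) _ hsub fun r hr => ⟨hc0 r hr, ?_⟩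
      rw [← hc0 r hr]
      have := (hm r (Finset.mem_filter.1 hr).1).2
      linear_combination -this
    · have hm1 : ∀ r ∈ T.filter (fun r => ¬ (rho q (de q.1 F)).eval (tt q r) = 0),
        r.2.1 = (q.2.1 + (1 + c0 * q.1) / c1) + (- c0 / c1) * r.1 := by
        intro r hr
        have := key r hr
        field_simp
        linear_combination this
      refine hG.aff _ _ (q.2.2 - q.1 * (q.2.1 + (1 + c0 * q.1) / c1)) (q.2.1 - q.1 * (- c0 / c1)) _ hsub fun r hr => ⟨hm1 r hr, ?_⟩
      have h1 := (hm r (Finset.mem_filter.1 hr).1).2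
      have h2 := hm1 r hr
      linear_combination -h1 - q.1 * h2

theorem irr (p : ℕ) [CharP K p] (F : MP K) (hF : Irreducible F) (d κ : ℕ) (hd : F.totalDegree ≤ d)
    (hdp : 2 * d < p) (W : Finset (K × K × K)) (hW : ∀ r ∈ W, rho r F = 0) (hG : Gthree κ W) :
    ∃ Bad ⊆ W, Bad.card ≤ 30 * (d * d) ∧ ∀ q ∈ W, q ∉ Bad → ∀ T ⊆ W, (∀ r ∈ T, meets q r) →
      Set.InjOn (tt q) T → T.card ≤ 5 * d + κ := by
  classical
  have bz : ∀ (E : MP K) (b : ℕ), E.totalDegree ≤ b → ¬ F ∣ E →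
      (W.filter (fun q => rho q E = 0)).card ≤ 6 * d * b := by
    intro E b hb hE
    exact bezout F E hF hE d b hd hb _ fun q hq =>
      ⟨hW q (Finset.mem_filter.1 hq).1, (Finset.mem_filter.1 hq).2⟩
  have rt : ∀ q (T : Finset (K × K × K)), Set.InjOn (tt q) T → ∀ (E : MP K) (b : ℕ), E.totalDegree ≤ b →
      rho q E ≠ 0 → (∀ r ∈ T, (rho q E).eval (tt q r) = 0) → T.card ≤ b := by
    intro q T hT E b hb h0 h
    exact (card_roots_le q T hT _ h0 h).trans ((rho_natDegree _ _).trans hb)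
  by_cases hw : pderiv 2 F = 0
  · by_cases hv : pderiv 1 F = 0
    · have hu : pderiv 0 F ≠ 0 := by
        intro hu
        exact exists_pderiv p F hF (by omega) (by intro i; fin_cases i <;> assumption)
      refine ⟨_, Finset.filter_subset (fun q => rho q (pderiv 0 F) = 0) W, ?_, ?_⟩
      · refine (bz _ d (dg_pd _ hd) (not_dvd_pderiv _ _ hu)).trans (by nlinarith)
      · intro q hq hqn
        exfalso
        apply hqn
        have := line1 (hW q hq)
        rw [hw, hv] at this
        exact Finset.mem_filter.2 ⟨hq, by simpa using this⟩
    · refine ⟨_, Finset.filter_subset (fun q => rho q (pderiv 1 F) = 0) W, ?_, ?_⟩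
      · refine (bz _ d (dg_pd _ hd) (not_dvd_pderiv _ _ hv)).trans (by nlinarith)
      · intro q hq hqn T hT hm hi
        refine (rt q T hi (pderiv 1 F) d (dg_pd _ hd) (fun h => hqn (Finset.mem_filter.2 ⟨hq, h⟩)) ?_).trans (by omega)
        intro r hr
        have := nb1 (hW q hq) (hW r (hT hr)) (hm r hr)
        rw [this, hw]; simp
  · -- main case: choose the second exceptional set
    have hB2 : ∃ B2 ⊆ W, B2.card ≤ 24 * (d * d) ∧ ∀ q ∈ W, q ∉ B2 → rho q (E1P F) = 0 →
        rho q (E2P F) = 0 → F ∣ E1P F ∧ F ∣ E2P F := by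
      by_cases h1 : F ∣ E1P F
      · by_cases h2 : F ∣ E2P F
        · exact ⟨∅, by simp, by simp, fun _ _ _ _ _ => ⟨h1, h2⟩⟩
        · refine ⟨_, Finset.filter_subset (fun q => rho q (E2P F) = 0) W,
            (bz _ _ (dg_E2 hd) h2).trans (by nlinarith), ?_⟩
          intro q hq hqn _ h
          exact absurd (Finset.mem_filter.2 ⟨hq, h⟩) hqn
      · refine ⟨_, Finset.filter_subset (fun q => rho q (E1P F) = 0) W,
            (bz _ _ (dg_E1 hd) h1).trans (by nlinarith), ?_⟩
        intro q hq hqn h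
        exact absurd (Finset.mem_filter.2 ⟨hq, h⟩) hqn
    obtain ⟨B2, hB2W, hB2c, hB2⟩ := hB2
    refine ⟨W.filter (fun q => rho q (pderiv 2 F) = 0) ∪ B2,
      Finset.union_subset (Finset.filter_subset _ _) hB2W, ?_, ?_⟩
    · refine (Finset.card_union_le _ _).trans ?_
      have := bz _ d (dg_pd 2 hd) (not_dvd_pderiv _ _ hw)
      nlinarith
    · intro q hq hqn T hT hm hi
      rw [Finset.mem_union, not_or] at hqn
      have hn : rho q (pderiv 2 F) ≠ 0 := fun h => hqn.1 (Finset.mem_filter.2 ⟨hq, h⟩)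
      by_cases hv : rho q (de q.1 F) = 0
      · refine (rt q T hi (pderiv 2 F) d (dg_pd _ hd) hn ?_).trans (by omega)
        intro r hr
        have h1 := nb1 (hW q hq) (hW r (hT hr)) (hm r hr)
        have h2 := congrArg (Polynomial.eval (tt q r)) hv
        rw [de_apply] at h2
        simp only [map_sub, map_mul, map_ofNat, rho_C, Polynomial.eval_sub, Polynomial.eval_mul, Polynomial.eval_C, Polynomial.eval_ofNat, Polynomial.eval_zero] at h2
        have h3 : (r.1 - q.1) ≠ 0 := sub_ne_zero.2 (hm r hr).1.symm
        apply (mul_eq_zero.1 (?_ : (r.1 - q.1) * _ = 0)).resolve_left h3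
        linear_combination h2 - h1
      · by_cases hQ : rho q (QP q.1 F) = 0
        · obtain ⟨e1, e2⟩ := flecE (hW q hq) hQ hv
          obtain ⟨f1, f2⟩ := hB2 q hq hqn.2 e1 e2
          obtain ⟨c0, c1, hc⟩ := ode p F d hd hdp q (hW q hq) f1 f2 hn hv
          exact (ruled hd (hW q hq) hv c0 c1 hc hG hW T hT hm hi).trans (by omega)
        · refine (rt q T hi _ (5 * d) (dg_Q q.1 hd) hQ ?_).trans (by omega)
          intro r hr
          exact nbQ (hW q hq) (hW r (hT hr)) (hm r hr)

end Irr
end DS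


namespace DS
set_option linter.unusedSimpArgs false
section Greedy
open Classical in
/-- ordered edges between two sets -/
noncomputable def eN {α : Type} (adj : α → α → Prop) (X Y : Finset α) : ℕ :=
  ∑ q ∈ X, (Y.filter (adj q)).card

variable {α : Type} (adj : α → α → Prop)

lemma eN_le (X Y : Finset α) (b : ℕ) (h : ∀ q ∈ X, ∀ T ⊆ Y, (∀ r ∈ T, adj q r) → T.card ≤ b) :
    eN adj X Y ≤ b * X.card := by
  classical
  unfold eN
  rw [mul_comm, ← smul_eq_mul]
  exact Finset.sum_le_card_nsmul _ _ _ fun q hq => h q hq _ (Finset.filter_subset _ _)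
    fun r hr => (Finset.mem_filter.1 hr).2

lemma eN_comm (hs : ∀ q r, adj q r → adj r q) (X Y : Finset α) : eN adj X Y = eN adj Y X := by
  classical
  unfold eN
  simp only [Finset.card_filter]
  rw [Finset.sum_comm]
  refine Finset.sum_congr rfl fun q _ => Finset.sum_congr rfl fun r _ => ?_
  have : adj r q ↔ adj q r := ⟨hs _ _, hs _ _⟩
  simp [this]

lemma eN_mono {X X' Y Y' : Finset α} (h : X ⊆ X') (h' : Y ⊆ Y') : eN adj X Y ≤ eN adj X' Y' := by
  classical
  unfold eN
  refine (Finset.sum_le_sum fun q _ => Finset.card_le_card (Finset.filter_subset_filter _ h')).trans ?_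
  exact Finset.sum_le_sum_of_subset h

lemma eN_union_left [DecidableEq α] (X X' Y : Finset α) : eN adj (X ∪ X') Y ≤ eN adj X Y + eN adj X' Y := by
  unfold eN
  rw [← Finset.sum_union_inter]
  exact Nat.le_add_right _ _

lemma eN_union_left_disj [DecidableEq α] (X X' Y : Finset α) (h : Disjoint X X') :
    eN adj (X ∪ X') Y = eN adj X Y + eN adj X' Y := by
  unfold eN
  rw [Finset.sum_union h]

/-- split a set as `X ∪ X'` -/
lemma eN_split [DecidableEq α] (hs : ∀ q r, adj q r → adj r q) (S X X' : Finset α) (h : S ⊆ X ∪ X') :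
    eN adj S S ≤ eN adj X X + 2 * eN adj X' X + eN adj X' X' := by
  have h1 := eN_mono adj h h
  have h2 := eN_union_left adj X X' (X ∪ X')
  have h3 := eN_union_left adj X X' X
  have h4 := eN_union_left adj X X' X'
  rw [eN_comm adj hs X, eN_comm adj hs X'] at h2
  have h5 := eN_comm adj hs X X'
  omega

/-- edges not inside `B` are controlled by degrees outside `B` -/
lemma eN_bad [DecidableEq α] (hs : ∀ q r, adj q r → adj r q) (W B : Finset α) (hB : B ⊆ W) (b : ℕ)
    (h : ∀ q ∈ W, q ∉ B → ∀ T ⊆ W, (∀ r ∈ T, adj q r) → T.card ≤ b) :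
    eN adj W W ≤ eN adj B B + 2 * b * W.card := by
  have h1 : W ⊆ B ∪ (W \ B) := by intro x hx; by_cases hxB : x ∈ B <;> simp [hx, hxB]
  have h2 := eN_mono adj h1 (le_refl W)
  have h3 := eN_union_left adj B (W \ B) W
  have h4 := eN_mono adj (le_refl B) h1
  have h5 := eN_union_left adj B (W \ B) B
  rw [eN_comm adj hs, ] at h5
  have h6 : eN adj (W \ B) W ≤ b * (W \ B).card := eN_le adj _ _ b fun q hq T hT hr => by
    rw [Finset.mem_sdiff] at hq
    exact h q hq.1 hq.2 T hT hr
  have h7 : eN adj (W \ B) B ≤ eN adj (W \ B) W := eN_mono adj (le_refl _) hB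
  have h8 : b * (W \ B).card ≤ b * W.card := Nat.mul_le_mul_left _ (Finset.card_le_card Finset.sdiff_subset)
  nlinarith

open Classical in
theorem greedy (S R : Finset α) (hR : R ⊆ S) (M d n : ℕ)
    (hM : ∀ r ∈ R, M ≤ (S.filter (adj r)).card) (hn : 16 * S.card * (d + 1) < n * (M - d)) :
    ∃ S0 ⊆ S, S0.card ≤ n ∧ 16 * (R.filter (fun r => (S0.filter (adj r)).card ≤ d)).card ≤ S.card := by
  by_contra hcon
  push Not at hcon
  set Φ : Finset α → ℕ := fun S0 => ∑ r ∈ R, min (S0.filter (adj r)).card (d + 1) with hΦ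
  have claim : ∀ j ≤ n, ∃ S0 ⊆ S, S0.card ≤ j ∧ j * (M - d) ≤ 16 * Φ S0 := by
    intro j
    induction j with
    | zero => intro _; exact ⟨∅, by simp, by simp, by simp⟩
    | succ j ih =>
      intro hj
      obtain ⟨S0, hS0, hc, hΦ0⟩ := ih (by omega)
      have hU := hcon S0 hS0 (by omega)
      set U := R.filter (fun r => (S0.filter (adj r)).card ≤ d) with hUdef
      have hex : ∃ q ∈ S \ S0, M - d ≤ 16 * (U.filter (fun r => adj r q)).card := by
        by_contra hno
        push Not at hno
        have h1 : ∑ q ∈ S \ S0, 16 * (U.filter (fun r => adj r q)).card ≤ S.card * (M - d) := by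
          refine (Finset.sum_le_card_nsmul _ _ (M - d) fun q hq => (hno q hq).le).trans ?_
          rw [smul_eq_mul]
          exact Nat.mul_le_mul_right _ (Finset.card_le_card Finset.sdiff_subset)
        have h2 : ∑ q ∈ S \ S0, (U.filter (fun r => adj r q)).card =
            ∑ r ∈ U, ((S \ S0).filter (adj r)).card := by
          simp only [Finset.card_filter]
          rw [Finset.sum_comm]
        have h3 : U.card * (M - d) ≤ ∑ r ∈ U, ((S \ S0).filter (adj r)).card := by
          rw [← smul_eq_mul]
          apply Finset.card_nsmul_le_sum
          intro r hr
          obtain ⟨hrR, hrd⟩ := Finset.mem_filter.1 hr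
          have := hM r hrR
          have h4 : (S.filter (adj r)).card ≤ ((S \ S0).filter (adj r)).card + (S0.filter (adj r)).card := by
            refine le_trans (Finset.card_le_card ?_) (Finset.card_union_le _ _)
            intro x hx
            obtain ⟨hx1, hx2⟩ := Finset.mem_filter.1 hx
            by_cases hxS : x ∈ S0 <;> simp [hx1, hx2, hxS]
          omega
        rw [← Finset.mul_sum, h2] at h1
        have hMd : 0 < M - d := by
          by_contra h; have : M - d = 0 := by omega
          rw [this] at hn; omega
        have : S.card * (M - d) < 16 * U.card * (M - d) := Nat.mul_lt_mul_of_pos_right hU hMd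
        nlinarith
      obtain ⟨q, hq, hqU⟩ := hex
      obtain ⟨hqS, hqS0⟩ := Finset.mem_sdiff.1 hq
      refine ⟨insert q S0, Finset.insert_subset hqS hS0, (Finset.card_insert_le _ _).trans (by omega), ?_⟩
      have hstep : Φ S0 + (U.filter (fun r => adj r q)).card ≤ Φ (insert q S0) := by
        have : (U.filter (fun r => adj r q)).card =
            ∑ r ∈ R, if ((S0.filter (adj r)).card ≤ d ∧ adj r q) then 1 else 0 := by
          rw [hUdef, Finset.filter_filter, Finset.card_filter]
        rw [this, hΦ]
        simp only
        rw [← Finset.sum_add_distrib]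
        refine Finset.sum_le_sum fun r _ => ?_
        rw [Finset.filter_insert]
        by_cases h : adj r q
        · rw [if_pos h, Finset.card_insert_of_notMem (by simp [hqS0])]
          split_ifs <;> omega
        · rw [if_neg h, if_neg (fun h' => h h'.2)]; simp
      rw [add_mul, one_mul]
      omega
  obtain ⟨S0, _, _, h⟩ := claim n le_rfl
  have h2 : Φ S0 ≤ S.card * (d + 1) := by
    refine (Finset.sum_le_card_nsmul _ _ (d + 1) fun r _ => min_le_right _ _).trans ?_
    rw [smul_eq_mul]
    exact Nat.mul_le_mul_right _ (Finset.card_le_card hR)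
  nlinarith
end Greedy

section Comp
variable {K : Type} [Field K]

structure Good (adj : K × K × K → K × K × K → Prop) (S : Finset (K × K × K)) : Prop where
  symm : ∀ q r, adj q r → adj r q
  meet : ∀ q ∈ S, ∀ r ∈ S, adj q r → meets q r
  inj : ∀ q ∈ S, ∀ r ∈ S, ∀ r' ∈ S, adj q r → adj q r' → tt q r = tt q r' → r = r'

lemma Good.mono {adj : K × K × K → K × K × K → Prop} {S S' : Finset (K × K × K)} (h : Good adj S)
    (hs : S' ⊆ S) : Good adj S' :=
  ⟨h.symm, fun q hq r hr => h.meet q (hs hq) r (hs hr),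
   fun q hq r hr r' hr' => h.inj q (hs hq) r (hs hr) r' (hs hr')⟩

/-- a line not inside the surface meets at most `d` lines inside -/
lemma out_deg {adj : K × K × K → K × K × K → Prop} {S : Finset (K × K × K)} (h : Good adj S)
    (F : MP K) (q : K × K × K) (hq : q ∈ S) (hqF : rho q F ≠ 0) (T : Finset (K × K × K)) (hT : T ⊆ S)
    (hTF : ∀ r ∈ T, rho r F = 0) (hadj : ∀ r ∈ T, adj q r) : T.card ≤ F.totalDegree := by
  refine (card_roots_le q T ?_ _ hqF ?_).trans (rho_natDegree _ _)
  · intro r hr r' hr' he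
    exact h.inj q hq r (hT hr) r' (hT hr') (hadj r hr) (hadj r' hr') he
  · intro r hr
    rw [rho_eval, pt_eq (h.meet q hq r (hT hr) (hadj r hr)), ← rho_eval, hTF r hr]
    simp

theorem comp (p : ℕ) [CharP K p] (adj : K × K × K → K × K × K → Prop) (κ : ℕ) (F : MP K) (hF : F ≠ 0) :
    2 * F.totalDegree < p → ∀ W : Finset (K × K × K), Good adj W → Gthree κ W →
    (∀ q ∈ W, rho q F = 0) →
    ∃ B ⊆ W, B.card ≤ 30 * (F.totalDegree * F.totalDegree) ∧
      eN adj W W ≤ eN adj B B + (10 * F.totalDegree + 2 * κ) * W.card := by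
  classical
  refine WfDvdMonoid.induction_on_irreducible (motive := fun F : MP K => F ≠ 0 →
    2 * F.totalDegree < p → ∀ W : Finset (K × K × K), Good adj W → Gthree κ W →
    (∀ q ∈ W, rho q F = 0) →
    ∃ B ⊆ W, B.card ≤ 30 * (F.totalDegree * F.totalDegree) ∧
      eN adj W W ≤ eN adj B B + (10 * F.totalDegree + 2 * κ) * W.card) F ?_ ?_ ?_ hF
  · intro h; exact absurd rfl h
  · intro u hu _ _ W _ _ hW
    have : W = ∅ := by
      apply Finset.eq_empty_of_forall_notMem
      intro q hq
      have := hu.map (rho q)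
      rw [hW q hq] at this
      exact not_isUnit_zero this
    subst this
    exact ⟨∅, by simp, by simp, by simp⟩
  · intro F' F1 hF' hF1 ih _ hdeg W hgood hG hW
    rw [MvPolynomial.totalDegree_mul_of_isDomain hF1.ne_zero hF'] at hdeg ⊢
    set d1 := F1.totalDegree
    set D := F'.totalDegree
    set W1 := W.filter (fun q => rho q F1 = 0) with hW1
    set W2 := W.filter (fun q => ¬ rho q F1 = 0) with hW2
    have s1 : W1 ⊆ W := Finset.filter_subset _ _
    have s2 : W2 ⊆ W := Finset.filter_subset _ _
    have hcard : W1.card + W2.card = W.card := Finset.card_filter_add_card_filter_not _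
    have hdisj : Disjoint W1 W2 := Finset.disjoint_filter_filter_not _ _ _
    obtain ⟨B1, hB1, hB1c, hB1e⟩ := irr p F1 hF1 d1 κ le_rfl (by omega) W1
      (fun r hr => (Finset.mem_filter.1 hr).2) (hG.mono s1)
    obtain ⟨B2, hB2, hB2c, hB2e⟩ := ih hF' (by omega) W2 (hgood.mono s2) (hG.mono s2) (by
      intro q hq
      obtain ⟨hq1, hq2⟩ := Finset.mem_filter.1 hq
      have := hW q hq1
      rw [map_mul] at this
      exact (mul_eq_zero.1 this).resolve_left hq2)
    refine ⟨B1 ∪ B2, Finset.union_subset (hB1.trans s1) (hB2.trans s2), ?_, ?_⟩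
    · refine (Finset.card_union_le _ _).trans ?_
      nlinarith
    · have e0 := eN_split adj hgood.symm W W1 W2 (by
        intro x hx; by_cases h : rho x F1 = 0 <;> simp [hW1, hW2, hx, h])
      have e1 := eN_bad adj hgood.symm W1 B1 hB1 (5 * d1 + κ) (by
        intro q hq hqn T hT hadj
        refine hB1e q hq hqn T hT (fun r hr => hgood.meet q (s1 hq) r (s1 (hT hr)) (hadj r hr)) ?_
        intro r hr r' hr' he
        exact hgood.inj q (s1 hq) r (s1 (hT hr)) r' (s1 (hT hr')) (hadj r hr) (hadj r' hr') he)
      have e2 : eN adj W2 W1 ≤ d1 * W2.card := eN_le adj _ _ _ fun q hq T hT hadj =>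
        out_deg hgood F1 q (s2 hq) (Finset.mem_filter.1 hq).2 T (hT.trans s1)
          (fun r hr => (Finset.mem_filter.1 (hT hr)).2) hadj
      have e3 : eN adj B1 B1 + eN adj B2 B2 ≤ eN adj (B1 ∪ B2) (B1 ∪ B2) := by
        rw [eN_union_left_disj adj _ _ _ (hdisj.mono hB1 hB2)]
        exact add_le_add (eN_mono adj le_rfl Finset.subset_union_left)
          (eN_mono adj le_rfl Finset.subset_union_right)
      rw [← hcard]
      nlinarith [Nat.zero_le (D * W1.card), Nat.zero_le (d1 * W2.card)]

theorem interp (S0 : Finset (K × K × K)) (δ : ℕ) (h : S0.card * (3 * δ) < δ * δ * δ) :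
    ∃ F : MP K, F ≠ 0 ∧ F.totalDegree ≤ 3 * δ ∧ ∀ q ∈ S0, rho q F = 0 := by
  classical
  let B := box K (fun _ => δ)
  have hdeg : ∀ F ∈ B, F.totalDegree ≤ 3 * (δ - 1) := by
    intro F hF
    apply Finset.sup_le
    intro m hm
    rw [Finsupp.sum_fintype _ _ (by simp), Fin.sum_univ_three]
    have := mem_box.1 hF m hm
    have h0 := this 0; have h1 := this 1; have h2 := this 2
    omega
  have hδ : 0 < δ := by
    rcases Nat.eq_zero_or_pos δ with h0 | h0
    · rw [h0] at h; simp at h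
    · exact h0
  let T : B →ₗ[K] (S0 × Fin (3 * δ) → K) := LinearMap.pi fun x =>
    (Polynomial.lcoeff K (x.2 : ℕ)).comp ((rho x.1.1).toLinearMap.comp B.subtype)
  have hker : LinearMap.ker T ≠ ⊥ := by
    apply LinearMap.ker_ne_bot_of_finrank_lt
    rw [finrank_box, Module.finrank_fintype_fun_eq_card]
    simpa using h
  obtain ⟨F, hF, hF0⟩ := (Submodule.ne_bot_iff _).1 hker
  refine ⟨F.1, fun h => hF0 (Subtype.ext h), (hdeg _ F.2).trans (by omega), fun q hq => ?_⟩
  ext j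
  by_cases hj : j < 3 * δ
  · have := congrFun (LinearMap.mem_ker.1 hF) (⟨q, hq⟩, ⟨j, hj⟩)
    simpa [T] using this
  · rw [Polynomial.coeff_eq_zero_of_natDegree_lt]
    · simp
    · have := rho_natDegree q F.1
      have := hdeg _ F.2
      omega

end Comp
end DS


namespace DS
section Graph
variable {K : Type} [Field K]

/-- one step of the induction -/
theorem graph_step (p : ℕ) [CharP K p] (adj : K × K × K → K × K × K → Prop) (κ k M : ℕ)
    (S : Finset (K × K × K)) (hg : Good adj S) (hG : Gthree κ S) (hk : 0 < k) (hkp : 12 * k < p)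
    (hM : 16 * S.card * (6 * k + 1) < k * k * (M - 6 * k)) :
    ∃ U ⊆ S, ∃ B ⊆ S, 16 * U.card ≤ S.card ∧ B.card ≤ 1080 * (k * k) ∧
      eN adj S S ≤ eN adj U U + eN adj B B + (72 * k + 2 * κ + 2 * M) * S.card := by
  classical
  set R := S.filter (fun r => M ≤ (S.filter (adj r)).card) with hR
  have hRS : R ⊆ S := Finset.filter_subset _ _
  obtain ⟨S0, hS0, hS0c, hU⟩ := greedy adj S R hRS M (6 * k) (k * k)
    (fun r hr => (Finset.mem_filter.1 hr).2) hM
  set U := R.filter (fun r => (S0.filter (adj r)).card ≤ 6 * k) with hUdef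
  have hUS : U ⊆ S := (Finset.filter_subset _ _).trans hRS
  obtain ⟨F, hF0, hFd, hF⟩ := interp S0 (2 * k) (by
    have : S0.card * (3 * (2 * k)) ≤ k * k * (6 * k) := by
      have := Nat.mul_le_mul_right (6 * k) hS0c
      calc _ = S0.card * (6 * k) := by ring
        _ ≤ _ := this
    have h3 : 0 < k * k * k := by positivity
    nlinarith)
  have hFd' : F.totalDegree ≤ 6 * k := by omega
  set W := S.filter (fun q => rho q F = 0) with hW
  set X := S.filter (fun q => ¬ rho q F = 0) with hX
  have sW : W ⊆ S := Finset.filter_subset _ _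
  have sX : X ⊆ S := Finset.filter_subset _ _
  have hcard : W.card + X.card = S.card := Finset.card_filter_add_card_filter_not _
  obtain ⟨B, hB, hBc, hBe⟩ := comp p adj κ F hF0 (by omega) W (hg.mono sW) (hG.mono sW)
    (fun q hq => (Finset.mem_filter.1 hq).2)
  refine ⟨U, hUS, B, hB.trans sW, hU, hBc.trans ?_, ?_⟩
  · have := Nat.mul_le_mul hFd' hFd'
    nlinarith
  have e0 := eN_split adj hg.symm S W X (by
    intro x hx; by_cases h : rho x F = 0 <;> simp [hW, hX, hx, h])
  have e1 : eN adj X W ≤ 6 * k * X.card := eN_le adj _ _ _ fun q hq T hT hadj =>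
    (out_deg hg F q (sX hq) (Finset.mem_filter.1 hq).2 T (hT.trans sW)
      (fun r hr => (Finset.mem_filter.1 (hT hr)).2) hadj).trans hFd'
  have e2 : eN adj X X ≤ eN adj (U ∩ X) (U ∩ X) + 2 * M * X.card := by
    apply eN_bad adj hg.symm X (U ∩ X) Finset.inter_subset_right
    intro q hq hqU T hT hadj
    by_contra hlt
    push Not at hlt
    apply hqU
    have hqS := sX hq
    have hTS : T.card ≤ (S.filter (adj q)).card := Finset.card_le_card fun r hr =>
      Finset.mem_filter.2 ⟨sX (hT hr), hadj r hr⟩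
    refine Finset.mem_inter.2 ⟨Finset.mem_filter.2 ⟨Finset.mem_filter.2 ⟨hqS, by omega⟩, ?_⟩, hq⟩
    refine (out_deg hg F q hqS (Finset.mem_filter.1 hq).2 _ ((Finset.filter_subset _ _).trans hS0)
      (fun r hr => hF r (Finset.mem_filter.1 hr).1) (fun r hr => (Finset.mem_filter.1 hr).2)).trans hFd'
  have e3 : eN adj (U ∩ X) (U ∩ X) ≤ eN adj U U :=
    eN_mono adj Finset.inter_subset_left Finset.inter_subset_left
  have e4 : (10 * F.totalDegree + 2 * κ) * W.card ≤ (60 * k + 2 * κ) * W.card :=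
    Nat.mul_le_mul_right _ (by omega)
  rw [← hcard]
  nlinarith [Nat.zero_le (k * X.card), Nat.zero_le (κ * X.card), Nat.zero_le (M * W.card), Nat.zero_le (k * W.card)]

theorem graph (p : ℕ) [CharP K p] (adj : K × K × K → K × K × K → Prop) (κ : ℕ) : ∀ (N : ℕ) 
    (S : Finset (K × K × K)), S.card = N → Good adj S → Gthree κ S → N ≤ p * p →
    (eN adj S S : ℝ) ≤ N * (10 ^ 8 * √N + 4 * κ) := by
  intro N
  induction N using Nat.strong_induction_on with
  | _ N ih =>
  intro S hS hg hG hNp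
  by_cases hsmall : N < 40000
  · have h1 : eN adj S S ≤ N * N := by
      have := eN_le adj S S N (fun q _ T hT _ => by rw [← hS]; exact Finset.card_le_card hT)
      rwa [hS] at this
    have h2 : (N : ℝ) ≤ 200 * √N := by
      have h3 : √(N : ℝ) ≤ 200 := by
        rw [Real.sqrt_le_left (by norm_num)]
        have : (N : ℝ) < 40000 := by exact_mod_cast hsmall
        linarith
      have h4 := Real.mul_self_sqrt (Nat.cast_nonneg (α := ℝ) N)
      nlinarith [Real.sqrt_nonneg (N : ℝ)]
    have h3 : (eN adj S S : ℝ) ≤ N * N := by exact_mod_cast h1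
    refine h3.trans (mul_le_mul_of_nonneg_left ?_ (Nat.cast_nonneg _))
    have : (0 : ℝ) ≤ κ := Nat.cast_nonneg _
    nlinarith [Real.sqrt_nonneg (N : ℝ)]
  · push Not at hsmall
    set s := Nat.sqrt N with hs
    have hs1 : s * s ≤ N := Nat.sqrt_le N
    have hs2 : N < (s + 1) * (s + 1) := Nat.lt_succ_sqrt N
    have hs3 : 200 ≤ s := by rw [hs, Nat.le_sqrt]; omega
    set k := s / 200 with hkdef
    have hk : 0 < k := by omega
    have hk1 : 200 * k ≤ s := by omega
    have hk2 : s + 1 ≤ 400 * k := by omega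
    have hsp : s ≤ p := by
      by_contra h
      push Not at h
      nlinarith
    have hNk : N ≤ 160000 * (k * k) := by nlinarith
    obtain ⟨U, hUS, B, hBS, hUc, hBc, he⟩ := graph_step p adj κ k (2 * 10 ^ 7 * k) S hg hG hk (by omega) (by
      rw [hS]
      have e : 2 * 10 ^ 7 * k - 6 * k = 19999994 * k := by omega
      rw [e]
      have h1 : 16 * N * (6 * k + 1) ≤ 16 * (160000 * (k * k)) * (7 * k) :=
        Nat.mul_le_mul (Nat.mul_le_mul_left _ hNk) (by omega)
      have h3 : 0 < k * k * k := by positivity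
      nlinarith)
    rw [hS] at hUc he
    have hBc' : 16 * B.card ≤ N := by nlinarith
    have iU := ih U.card (by omega) U rfl (hg.mono hUS) (hG.mono hUS) (by omega)
    have iB := ih B.card (by omega) B rfl (hg.mono hBS) (hG.mono hBS) (by omega)
    have hr : ∀ n : ℕ, 16 * n ≤ N → (n : ℝ) * (10 ^ 8 * √n + 4 * κ) ≤ (N / 16) * (10 ^ 8 * (√N / 4) + 4 * κ) := by
      intro n hn
      have h1 : (n : ℝ) ≤ N / 16 := by
        rw [le_div_iff₀ (by norm_num)]; exact_mod_cast (by omega : n * 16 ≤ N)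
      have h2 : √(n : ℝ) ≤ √N / 4 := by
        rw [Real.sqrt_le_left (by positivity), div_pow, Real.sq_sqrt (by positivity)]
        linarith
      have hκ : (0 : ℝ) ≤ κ := Nat.cast_nonneg _
      refine mul_le_mul h1 ?_ (by positivity) (by positivity)
      linarith
    have hU2 := iU.trans (hr _ hUc)
    have hB2 := iB.trans (hr _ hBc')
    have he' : (eN adj S S : ℝ) ≤ eN adj U U + eN adj B B + (72 * k + 2 * κ + 2 * (2 * 10 ^ 7 * k)) * N := by
      exact_mod_cast he
    have hks : (200 * k : ℝ) ≤ √N := by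
      apply Real.le_sqrt_of_sq_le
      have : (200 * k) * (200 * k) ≤ N := by nlinarith
      have h2 : ((200 * k) * (200 * k) : ℝ) ≤ N := by exact_mod_cast this
      nlinarith
    have hN0 : (0 : ℝ) ≤ N := Nat.cast_nonneg _
    have hκ : (0 : ℝ) ≤ κ := Nat.cast_nonneg _
    have h5 : (72 * k + 2 * κ + 2 * (2 * 10 ^ 7 * k)) * (N : ℝ) ≤ (10 ^ 7 * √N + 2 * κ) * N := by
      apply mul_le_mul_of_nonneg_right _ hN0
      nlinarith
    have h6 : (0 : ℝ) ≤ N * √N := by positivity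
    have h7 : (0 : ℝ) ≤ N * κ := by positivity
    linarith

end Graph
end DS


namespace DS
section Appl

lemma exists_lam (p : ℕ) [Fact p.Prime] : ∃ lam : AlgebraicClosure (ZMod p),
    ∀ x : ZMod p, algebraMap (ZMod p) (AlgebraicClosure (ZMod p)) x ≠ lam := by
  have h : Infinite (AlgebraicClosure (ZMod p)) := IsAlgClosed.instInfinite
  have h2 : (Set.range (algebraMap (ZMod p) (AlgebraicClosure (ZMod p)))).Finite := Set.finite_range _
  obtain ⟨x, hx⟩ := h2.exists_notMem
  exact ⟨x, fun y hy => hx ⟨y, hy⟩⟩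

section Model
variable {F K : Type} [Field F] [Field K] (ι : F →+* K) (lam : K)

def p1 (x : F × F × F) : K × K × K := (ι x.1, lam * ι x.2.1, ι x.2.2)
def p2 (x : F × F × F) : K × K × K := (ι x.1 / lam, ι x.2.1, ι x.2.2)

/-- adjacency in the bipartite incidence graph; the last alternative is symmetric -/
def adjM (q r : K × K × K) : Prop :=
  ∃ x y : F × F × F, x.1 ≠ 0 ∧ y.1 ≠ 0 ∧ x.2.2 ≠ y.2.2 ∧ y.2.1 * x.1 + y.2.2 = x.2.1 * y.1 + x.2.2 ∧
    ((q = p1 ι lam x ∧ r = p2 ι lam y) ∨ (r = p1 ι lam x ∧ q = p2 ι lam y))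


lemma lam_ne (hlam : ∀ x : F, ι x ≠ lam) : lam ≠ 0 := fun h => hlam 0 (by simp [h])

lemma lam_indep (hlam : ∀ x : F, ι x ≠ lam) {x y : F} (h : lam * ι x = ι y) : x = 0 ∧ y = 0 := by
  have hx : x = 0 := by
    by_contra hx
    apply hlam (y / x)
    rw [map_div₀, ← h]
    exact mul_div_cancel_right₀ _ (by simpa using hx)
  refine ⟨hx, ?_⟩
  rw [hx, map_zero, mul_zero] at h
  exact (map_eq_zero ι).1 h.symm

lemma p12 (hlam : ∀ x : F, ι x ≠ lam) {x y : F × F × F} (hx : x.1 ≠ 0) (h : p1 ι lam x = p2 ι lam y) : False := by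
  have h1 := congrArg Prod.fst h
  have h0 := lam_ne ι lam hlam
  simp only [p1, p2] at h1
  rw [eq_div_iff h0, mul_comm] at h1
  exact hx (lam_indep ι lam hlam h1).1

lemma p1_inj (hlam : ∀ x : F, ι x ≠ lam) : Function.Injective (p1 ι lam) := by
  intro x y h
  have h0 := lam_ne ι lam hlam
  simp only [p1, Prod.mk.injEq] at h
  refine Prod.ext (ι.injective h.1) (Prod.ext (ι.injective (mul_left_cancel₀ h0 h.2.1)) (ι.injective h.2.2))

lemma p2_inj (hlam : ∀ x : F, ι x ≠ lam) : Function.Injective (p2 ι lam) := by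
  intro x y h
  have h0 := lam_ne ι lam hlam
  simp only [p2, Prod.mk.injEq] at h
  refine Prod.ext (ι.injective ?_) (Prod.ext (ι.injective h.2.1) (ι.injective h.2.2))
  exact (div_left_inj' h0).1 h.1

lemma good_adjM (hlam : ∀ x : F, ι x ≠ lam) (S : Finset (K × K × K)) : Good (adjM ι lam) S := by
  have h0 := lam_ne ι lam hlam
  have meet1 : ∀ x y : F × F × F, x.1 ≠ 0 → y.2.1 * x.1 + y.2.2 = x.2.1 * y.1 + x.2.2 →
      meets (p1 ι lam x) (p2 ι lam y) := by
    intro x y hx h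
    refine ⟨?_, ?_⟩
    · simp only [p1, p2]
      intro h1
      rw [eq_div_iff h0, mul_comm] at h1
      exact hx (lam_indep ι lam hlam h1).1
    · simp only [p1, p2]
      have := congrArg ι h
      simp only [map_add, map_mul] at this
      field_simp
      linear_combination -this
  have msymm : ∀ q r : K × K × K, meets q r → meets r q := by
    intro q r h
    exact ⟨h.1.symm, by linear_combination -h.2⟩
  have hmeet : ∀ q r, adjM ι lam q r → meets q r := by
    rintro q r ⟨x, y, hx, hy, hc, h, ⟨rfl, rfl⟩ | ⟨rfl, rfl⟩⟩
    · exact meet1 x y hx h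
    · exact msymm _ _ (meet1 x y hx h)
  -- key consequence of a common parameter
  have key : ∀ q r r' : K × K × K, meets q r → meets q r' → tt q r = tt q r' →
      (q.2.2 - r.2.2) * (r.1 - r'.1) = (r.2.2 - r'.2.2) * (q.1 - r.1) ∧
      (r.1 = r'.1 → r = r') := by
    intro q r r' h h' he
    have e1 := tt_mul h
    have e2 := tt_mul h'
    rw [← he] at e2
    have e3 := h.2
    have e4 := h'.2
    set t := tt q r
    have m1 : r.2.1 = q.2.1 - t * (q.1 - r.1) := by linear_combination e1
    have m2 : r'.2.1 = q.2.1 - t * (q.1 - r'.1) := by linear_combination e2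
    rw [m1] at e3
    rw [m2] at e4
    constructor
    · linear_combination (q.1 - r'.1) * e3 - (q.1 - r.1) * e4
    · intro ha
      refine Prod.ext ha (Prod.ext ?_ ?_)
      · rw [m1, m2, ha]
      · rw [ha] at e3
        linear_combination e4 - e3
  refine ⟨?_, fun q _ r _ h => hmeet q r h, ?_⟩
  · rintro q r ⟨x, y, hx, hy, hc, h, h'⟩
    exact ⟨x, y, hx, hy, hc, h, h'.symm.imp (fun h => ⟨h.1, h.2⟩) (fun h => ⟨h.1, h.2⟩)⟩
  · intro q _ r _ r' _ h h' he
    obtain ⟨k1, k2⟩ := key q r r' (hmeet _ _ h) (hmeet _ _ h') he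
    apply k2
    obtain ⟨x, y, hx, hy, hc, _, hh⟩ := h
    obtain ⟨x', y', hx', hy', hc', _, hh'⟩ := h'
    rcases hh with ⟨hq, hr⟩ | ⟨hr, hq⟩
    · rcases hh' with ⟨hq', hr'⟩ | ⟨hr', hq'⟩
      · rw [hq, hr, hr'] at k1
        rw [hr, hr']
        simp only [p1, p2] at k1 ⊢
        have k3 : lam * ι ((y.2.2 - y'.2.2) * x.1) =
            ι ((x.2.2 - y.2.2) * (y.1 - y'.1) + (y.2.2 - y'.2.2) * y.1) := by
          simp only [map_mul, map_sub, map_add]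
          field_simp at k1
          linear_combination -k1
        obtain ⟨z1, z2⟩ := lam_indep ι lam hlam k3
        have z3 := (mul_eq_zero.1 z1).resolve_right hx
        rw [z3, zero_mul, add_zero] at z2
        have z4 := (mul_eq_zero.1 z2).resolve_left (sub_ne_zero.2 hc)
        rw [sub_eq_zero.1 z4]
      · exact (p12 ι lam hlam hx (hq.symm.trans hq')).elim
    · rcases hh' with ⟨hq', hr'⟩ | ⟨hr', hq'⟩
      · exact (p12 ι lam hlam hx' (hq'.symm.trans hq)).elim
      · rw [hq, hr, hr'] at k1
        rw [hr, hr']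
        simp only [p1, p2] at k1 ⊢
        have k3 : lam * ι ((y.2.2 - x.2.2) * (x.1 - x'.1) + (x.2.2 - x'.2.2) * x.1) =
            ι ((x.2.2 - x'.2.2) * y.1) := by
          simp only [map_mul, map_sub, map_add]
          field_simp at k1
          linear_combination k1
        obtain ⟨z1, z2⟩ := lam_indep ι lam hlam k3
        have z3 := (mul_eq_zero.1 z2).resolve_right hy
        rw [z3, zero_mul, add_zero] at z1
        have z4 := (mul_eq_zero.1 z1).resolve_left (sub_ne_zero.2 hc.symm)
        rw [sub_eq_zero.1 z4]

lemma conc (L : Finset (F × F)) (κ0 : ℕ) (hL : ∀ x y : F, ∀ T ⊆ L, (∀ l ∈ T, l.1 * x + l.2 = y) → T.card ≤ κ0)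
    (g h : K) (T : Finset (F × F)) (hT : T ⊆ L) (hT2 : ∀ l ∈ T, ι l.2 + g * ι l.1 = h) : T.card ≤ κ0 + 1 := by
  by_cases hg : ∃ g0, ι g0 = g
  · obtain ⟨g0, rfl⟩ := hg
    rcases T.eq_empty_or_nonempty with rfl | ⟨l0, hl0⟩
    · simp
    · refine (hL g0 (l0.2 + g0 * l0.1) T hT fun l hl => ι.injective ?_).trans (by omega)
      have h1 := hT2 l hl
      have h2 := hT2 l0 hl0
      simp only [map_add, map_mul]
      linear_combination h1 - h2
  · push Not at hg
    refine le_trans (Finset.card_le_one.2 ?_) (by omega : 1 ≤ κ0 + 1)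
    intro l hl l' hl'
    have h1 := hT2 l hl
    have h2 := hT2 l' hl'
    have h3 : g * ι (l.1 - l'.1) = ι (l'.2 - l.2) := by
      simp only [map_sub]; linear_combination h1 - h2
    obtain ⟨z1, z2⟩ := lam_indep ι g hg h3
    exact Prod.ext (sub_eq_zero.1 z1) (sub_eq_zero.1 z2).symm

open Classical in
lemma gthree_S (hlam : ∀ x : F, ι x ≠ lam) (A : Finset F) (L : Finset (F × F)) (κ0 : ℕ)
    (hL : ∀ x y : F, ∀ T ⊆ L, (∀ l ∈ T, l.1 * x + l.2 = y) → T.card ≤ κ0) :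
    Gthree (2 * A.card + 2 * κ0 + 2) ((A ×ˢ L).image (p1 ι lam) ∪ (A ×ˢ L).image (p2 ι lam)) := by
  have h0 := lam_ne ι lam hlam
  refine ⟨?_, ?_⟩
  · intro α β γ ε T hT h
    have hinj : Set.InjOn Prod.fst (T : Set (K × K × K)) := by
      intro r hr r' hr' he
      have h1 := h r hr
      have h2 := h r' hr'
      rw [he] at h1
      exact Prod.ext he (Prod.ext (h1.1.trans h2.1.symm) (h1.2.trans h2.2.symm))
    rw [← Finset.card_image_of_injOn hinj]
    have : T.image Prod.fst ⊆ A.image ι ∪ A.image (fun a => ι a / lam) := by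
      intro a ha
      obtain ⟨r, hr, rfl⟩ := Finset.mem_image.1 ha
      rcases Finset.mem_union.1 (hT hr) with h | h
      · obtain ⟨x, hx, rfl⟩ := Finset.mem_image.1 h
        exact Finset.mem_union_left _ (Finset.mem_image.2 ⟨x.1, (Finset.mem_product.1 hx).1, rfl⟩)
      · obtain ⟨x, hx, rfl⟩ := Finset.mem_image.1 h
        exact Finset.mem_union_right _ (Finset.mem_image.2 ⟨x.1, (Finset.mem_product.1 hx).1, rfl⟩)
    refine (Finset.card_le_card this).trans ((Finset.card_union_le _ _).trans ?_)
    have h1 := Finset.card_image_le (s := A) (f := ι)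
    have h2 := Finset.card_image_le (s := A) (f := fun a => ι a / lam)
    omega
  · intro a0 g h T hT hh
    set T1 := L.filter (fun l => ι l.2 + g * lam * ι l.1 = h) with hT1
    set T2 := L.filter (fun l => ι l.2 + g * ι l.1 = h) with hT2
    have c1 := conc ι L κ0 hL (g * lam) h T1 (Finset.filter_subset _ _)
      (fun l hl => (Finset.mem_filter.1 hl).2)
    have c2 := conc ι L κ0 hL g h T2 (Finset.filter_subset _ _)
      (fun l hl => (Finset.mem_filter.1 hl).2)
    have : T ⊆ T1.image (fun l => (a0, lam * ι l.1, ι l.2)) ∪ T2.image (fun l => (a0, ι l.1, ι l.2)) := by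
      intro r hr
      have h1 := hh r hr
      rcases Finset.mem_union.1 (hT hr) with h | h
      · obtain ⟨x, hx, rfl⟩ := Finset.mem_image.1 h
        refine Finset.mem_union_left _ (Finset.mem_image.2 ⟨x.2, Finset.mem_filter.2 ⟨(Finset.mem_product.1 hx).2, ?_⟩, ?_⟩)
        · rw [← h1.2]; simp only [p1]; ring
        · rw [← h1.1]; rfl
      · obtain ⟨x, hx, rfl⟩ := Finset.mem_image.1 h
        refine Finset.mem_union_right _ (Finset.mem_image.2 ⟨x.2, Finset.mem_filter.2 ⟨(Finset.mem_product.1 hx).2, ?_⟩, ?_⟩)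
        · rw [← h1.2]; rfl
        · rw [← h1.1]; rfl
    refine (Finset.card_le_card this).trans ((Finset.card_union_le _ _).trans ?_)
    have h1 := Finset.card_image_le (s := T1) (f := fun l => (a0, lam * ι l.1, ι l.2))
    have h2 := Finset.card_image_le (s := T2) (f := fun l => (a0, ι l.1, ι l.2))
    omega

end Model

open Classical in
/-- line energy -/
theorem energy0 (p : ℕ) [Fact p.Prime] (K : Type) [Field K] [CharP K p] (ι : ZMod p →+* K) (lam : K)
    (hlam : ∀ x : ZMod p, ι x ≠ lam) (A : Finset (ZMod p)) (L : Finset (ZMod p × ZMod p)) (κ0 : ℕ)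
    (hA : 0 ∉ A) (hp : 2 * (A.card * L.card) ≤ p * p)
    (hL : ∀ x y : ZMod p, ∀ T ⊆ L, (∀ l ∈ T, l.1 * x + l.2 = y) → T.card ≤ κ0) :
    ((((A ×ˢ L) ×ˢ (A ×ˢ L)).filter (fun z => z.1.2.1 * z.1.1 + z.1.2.2 = z.2.2.1 * z.2.1 + z.2.2.2)).card : ℝ)
      ≤ 2 * (A.card * L.card) * (2 * 10 ^ 8 * √(A.card * L.card) + 17 * A.card + 8 * κ0) := by
  set S := (A ×ˢ L).image (p1 ι lam) ∪ (A ×ˢ L).image (p2 ι lam) with hS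
  have hSc : S.card ≤ 2 * (A.card * L.card) := by
    refine (Finset.card_union_le _ _).trans ?_
    have h1 := Finset.card_image_le (s := A ×ˢ L) (f := p1 ι lam)
    have h2 := Finset.card_image_le (s := A ×ˢ L) (f := p2 ι lam)
    rw [Finset.card_product] at h1 h2
    omega
  have hgr := graph p (adjM ι lam) _ S.card S rfl (good_adjM ι lam hlam S)
    (gthree_S ι lam hlam A L κ0 hL) (hSc.trans hp)
  set Z := ((A ×ˢ L) ×ˢ (A ×ˢ L)).filter (fun z => z.1.2.1 * z.1.1 + z.1.2.2 = z.2.2.1 * z.2.1 + z.2.2.2) with hZ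
  -- equal intercepts
  have hZ1 : (Z.filter (fun z => z.1.2.2 = z.2.2.2)).card ≤ A.card * (A.card * L.card) := by
    rw [← Finset.card_product, ← Finset.card_product]
    refine Finset.card_le_card_of_injOn (fun z => (z.2.1, z.1)) ?_ ?_
    · intro z hz
      have := (Finset.mem_filter.1 (Finset.mem_filter.1 hz).1).1
      rw [Finset.mem_product] at this
      exact Finset.mem_coe.2 (Finset.mem_product.2 ⟨(Finset.mem_product.1 this.2).1, this.1⟩)
    · intro z hz z' hz' he
      obtain ⟨hz1, hz2⟩ := Finset.mem_filter.1 hz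
      obtain ⟨hz1', hz2'⟩ := Finset.mem_filter.1 hz'
      obtain ⟨hz3, hz4⟩ := Finset.mem_filter.1 hz1
      obtain ⟨hz3', hz4'⟩ := Finset.mem_filter.1 hz1'
      simp only [Prod.mk.injEq] at he
      obtain ⟨he1, he2⟩ := he
      have ha : z.2.1 ≠ 0 := fun h => hA (h ▸ (Finset.mem_product.1 (Finset.mem_product.1 hz3).2).1)
      refine Prod.ext he2 (Prod.ext he1 (Prod.ext ?_ ?_))
      · apply mul_right_cancel₀ ha
        rw [← he2, ← he1, ← hz2'] at hz4'
        rw [← hz2] at hz4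
        rw [← he2] at hz4'
        linear_combination hz4' - hz4
      · rw [← hz2, ← hz2', he2]
  have hZ2 : (Z.filter (fun z => ¬ z.1.2.2 = z.2.2.2)).card ≤ eN (adjM ι lam) S S := by
    unfold eN
    rw [← Finset.card_sigma]
    refine Finset.card_le_card_of_injOn (fun z => ⟨p1 ι lam (z.1.1, z.2.2.1, z.2.2.2), p2 ι lam (z.2.1, z.1.2.1, z.1.2.2)⟩) ?_ ?_
    · intro z hz
      obtain ⟨hz1, hz2⟩ := Finset.mem_filter.1 hz
      obtain ⟨hz3, hz4⟩ := Finset.mem_filter.1 hz1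
      obtain ⟨m1, m2⟩ := Finset.mem_product.1 hz3
      obtain ⟨m11, m12⟩ := Finset.mem_product.1 m1
      obtain ⟨m21, m22⟩ := Finset.mem_product.1 m2
      refine Finset.mem_coe.2 (Finset.mem_sigma.2 ⟨?_, Finset.mem_filter.2 ⟨?_, ?_⟩⟩)
      · exact Finset.mem_union_left _ (Finset.mem_image.2 ⟨(z.1.1, z.2.2), Finset.mem_product.2 ⟨m11, m22⟩, rfl⟩)
      · exact Finset.mem_union_right _ (Finset.mem_image.2 ⟨(z.2.1, z.1.2), Finset.mem_product.2 ⟨m21, m12⟩, rfl⟩)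
      · refine ⟨(z.1.1, z.2.2), (z.2.1, z.1.2), ?_, ?_, ?_, ?_, Or.inl ⟨rfl, rfl⟩⟩
        · exact fun h => hA (h ▸ m11)
        · exact fun h => hA (h ▸ m21)
        · exact fun h => hz2 h.symm
        · exact hz4
    · intro z hz z' hz' he
      simp only [Sigma.mk.injEq, heq_eq_eq] at he
      have h1 := p1_inj ι lam hlam he.1
      have h2 := p2_inj ι lam hlam he.2
      simp only [Prod.mk.injEq] at h1 h2
      refine Prod.ext (Prod.ext h1.1 (Prod.ext h2.2.1 h2.2.2)) (Prod.ext h2.1 (Prod.ext h1.2.1 h1.2.2))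
  have hZc : Z.card ≤ A.card * (A.card * L.card) + eN (adjM ι lam) S S := by
    rw [← Finset.card_filter_add_card_filter_not (s := Z) (fun z => z.1.2.2 = z.2.2.2)]
    exact add_le_add hZ1 hZ2
  have hZr : (Z.card : ℝ) ≤ A.card * (A.card * L.card) + eN (adjM ι lam) S S := by exact_mod_cast hZc
  rcases Nat.eq_zero_or_pos A.card with hA0 | hA0
  · have : Z = ∅ := by
      rw [Finset.card_eq_zero] at hA0
      rw [hZ, hA0]; simp
    rw [this, hA0]; simp
  have hA1 : (1 : ℝ) ≤ A.card := by exact_mod_cast hA0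
  set x : ℝ := (A.card : ℝ) * L.card with hx
  have hx0 : 0 ≤ x := by positivity
  have hSr : (S.card : ℝ) ≤ 2 * x := by rw [hx]; exact_mod_cast hSc
  have hsq : √(S.card : ℝ) ≤ 2 * √x := by
    rw [Real.sqrt_le_left (by positivity), mul_pow, Real.sq_sqrt hx0]
    linarith
  have hfin : (S.card : ℝ) * (10 ^ 8 * √S.card + 4 * ((2 * A.card + 2 * κ0 + 2 : ℕ) : ℝ)) ≤
      2 * x * (10 ^ 8 * (2 * √x) + 4 * ((2 * A.card + 2 * κ0 + 2 : ℕ) : ℝ)) := by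
    refine mul_le_mul hSr ?_ (by positivity) (by positivity)
    linarith
  push_cast at hfin hgr
  have h8 : x * 1 ≤ x * A.card := mul_le_mul_of_nonneg_left hA1 hx0
  nlinarith

open Classical in
theorem energy (p : ℕ) [Fact p.Prime] (A : Finset (ZMod p)) (L : Finset (ZMod p × ZMod p)) (κ0 : ℕ)
    (hA : 0 ∉ A) (hp : 2 * (A.card * L.card) ≤ p * p)
    (hL : ∀ x y : ZMod p, ∀ T ⊆ L, (∀ l ∈ T, l.1 * x + l.2 = y) → T.card ≤ κ0) :
    ((((A ×ˢ L) ×ˢ (A ×ˢ L)).filter (fun z => z.1.2.1 * z.1.1 + z.1.2.2 = z.2.2.1 * z.2.1 + z.2.2.2)).card : ℝ)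
      ≤ 2 * (A.card * L.card) * (2 * 10 ^ 8 * √(A.card * L.card) + 17 * A.card + 8 * κ0) := by
  obtain ⟨lam, hlam⟩ := exists_lam p
  exact energy0 p (AlgebraicClosure (ZMod p)) (algebraMap _ _) lam hlam A L κ0 hA hp hL

end Appl
end DS


namespace DS
section Sdz

open Classical in
lemma cs {X Y : Type} (S : Finset X) (B : Finset Y) (f : X → Y) (h : ∀ s ∈ S, f s ∈ B) :
    S.card ^ 2 ≤ B.card * ((S ×ˢ S).filter (fun z => f z.1 = f z.2)).card := by
  have h1 : S.card = ∑ b ∈ B, (S.filter (fun s => f s = b)).card :=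
    Finset.card_eq_sum_card_fiberwise h
  have h2 : ((S ×ˢ S).filter (fun z => f z.1 = f z.2)).card =
      ∑ b ∈ B, (S.filter (fun s => f s = b)).card ^ 2 := by
    rw [Finset.card_eq_sum_card_fiberwise (f := fun z : X × X => f z.1) (t := B)]
    · refine Finset.sum_congr rfl fun b _ => ?_
      rw [sq, ← Finset.card_product]
      congr 1
      ext z
      simp only [Finset.mem_filter, Finset.mem_product]
      constructor
      · rintro ⟨⟨⟨a, b⟩, c⟩, d⟩
        exact ⟨⟨a, d⟩, b, c ▸ d⟩
      · rintro ⟨⟨a, d⟩, b, c⟩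
        exact ⟨⟨⟨a, b⟩, d.trans c.symm⟩, d⟩
    · intro z hz
      exact h _ (Finset.mem_product.1 (Finset.mem_filter.1 hz).1).1
  rw [h2, h1]
  exact sq_sum_le_card_mul_sum_sq

open Classical in
lemma cs2 {X Y Z : Type} (S : Finset X) (G : Finset Z) (f : X → Y) (g : X → Z) (h : ∀ s ∈ S, g s ∈ G) :
    ((S ×ˢ S).filter (fun z => f z.1 = f z.2)).card ≤
      G.card * ((S ×ˢ S).filter (fun z => f z.1 = f z.2 ∧ g z.1 = g z.2)).card := by
  have hf : ∀ s ∈ S, f s ∈ S.image f := fun s hs => Finset.mem_image_of_mem f hs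
  have h2 : ((S ×ˢ S).filter (fun z => f z.1 = f z.2)).card =
      ∑ b ∈ S.image f, (S.filter (fun s => f s = b)).card ^ 2 := by
    rw [Finset.card_eq_sum_card_fiberwise (f := fun z : X × X => f z.1) (t := S.image f)]
    · refine Finset.sum_congr rfl fun b _ => ?_
      rw [sq, ← Finset.card_product]
      congr 1
      ext z
      simp only [Finset.mem_filter, Finset.mem_product]
      constructor
      · rintro ⟨⟨⟨a, b⟩, c⟩, d⟩
        exact ⟨⟨a, d⟩, b, c ▸ d⟩
      · rintro ⟨⟨a, d⟩, b, c⟩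
        exact ⟨⟨⟨a, b⟩, d.trans c.symm⟩, d⟩
    · intro z hz
      exact hf _ (Finset.mem_product.1 (Finset.mem_filter.1 hz).1).1
  have h3 : ((S ×ˢ S).filter (fun z => f z.1 = f z.2 ∧ g z.1 = g z.2)).card =
      ∑ b ∈ S.image f, (((S.filter (fun s => f s = b)) ×ˢ (S.filter (fun s => f s = b))).filter
        (fun z => g z.1 = g z.2)).card := by
    rw [Finset.card_eq_sum_card_fiberwise (f := fun z : X × X => f z.1) (t := S.image f)]
    · refine Finset.sum_congr rfl fun b _ => ?_
      congr 1
      ext z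
      simp only [Finset.mem_filter, Finset.mem_product]
      constructor
      · rintro ⟨⟨⟨a, b⟩, c, e⟩, d⟩
        exact ⟨⟨⟨a, d⟩, b, c ▸ d⟩, e⟩
      · rintro ⟨⟨⟨a, d⟩, b, c⟩, e⟩
        exact ⟨⟨⟨a, b⟩, d.trans c.symm, e⟩, d⟩
    · intro z hz
      exact hf _ (Finset.mem_product.1 (Finset.mem_filter.1 hz).1).1
  rw [h2, h3, Finset.mul_sum]
  exact Finset.sum_le_sum fun b _ => cs _ G g fun s hs => h s (Finset.mem_filter.1 hs).1

variable {p : ℕ} [Fact p.Prime]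

open Classical in
noncomputable def inc (A B : Finset (ZMod p)) (l : ZMod p × ZMod p) : ℕ :=
  (A.filter (fun a => l.1 * a + l.2 ∈ B)).card

lemma inc_le (A B : Finset (ZMod p)) (l : ZMod p × ZMod p) : inc A B l ≤ A.card :=
  Finset.card_filter_le _ _

open Classical in
lemma inc_erase (A B : Finset (ZMod p)) (l : ZMod p × ZMod p) (x : ZMod p) :
    inc A B l ≤ inc (A.erase x) B l + 1 := by
  unfold inc
  have : A.filter (fun a => l.1 * a + l.2 ∈ B) ⊆
      insert x ((A.erase x).filter (fun a => l.1 * a + l.2 ∈ B)) := by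
    intro a ha
    obtain ⟨h1, h2⟩ := Finset.mem_filter.1 ha
    by_cases h : a = x
    · exact Finset.mem_insert.2 (Or.inl h)
    · exact Finset.mem_insert.2 (Or.inr (Finset.mem_filter.2 ⟨Finset.mem_erase.2 ⟨h, h1⟩, h2⟩))
  exact (Finset.card_le_card this).trans (Finset.card_insert_le _ _)

open Classical in
lemma rich_conc (A B : Finset (ZMod p)) (k : ℕ) (T : Finset (ZMod p × ZMod p))
    (hk : ∀ l ∈ T, k ≤ inc A B l) (x y : ZMod p) (hT : ∀ l ∈ T, l.1 * x + l.2 = y) :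
    T.card * (k - 1) ≤ A.card * B.card := by
  have h1 : (T.card * (k - 1)) ≤ (T.sigma (fun l => (A.erase x).filter (fun a => l.1 * a + l.2 ∈ B))).card := by
    rw [Finset.card_sigma, ← smul_eq_mul]
    refine Finset.card_nsmul_le_sum _ _ _ fun l hl => ?_
    have h2 := inc_erase A B l x
    have h3 := hk l hl
    unfold inc at h2 h3
    omega
  refine h1.trans ?_
  rw [← Finset.card_product]
  refine Finset.card_le_card_of_injOn (fun z => (z.2, z.1.1 * z.2 + z.1.2)) ?_ ?_
  · intro z hz
    obtain ⟨h2, h3⟩ := Finset.mem_sigma.1 hz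
    obtain ⟨h4, h5⟩ := Finset.mem_filter.1 h3
    exact Finset.mem_coe.2 (Finset.mem_product.2 ⟨Finset.mem_of_mem_erase h4, h5⟩)
  · rintro ⟨l, a⟩ hz ⟨l', a'⟩ hz' he
    obtain ⟨h2, h3⟩ := Finset.mem_sigma.1 hz
    obtain ⟨h2', h3'⟩ := Finset.mem_sigma.1 hz'
    simp only [Prod.mk.injEq] at he
    obtain ⟨rfl, he⟩ := he
    have hne : a - x ≠ 0 := sub_ne_zero.2 (Finset.ne_of_mem_erase (Finset.mem_filter.1 h3).1)
    have e1 := hT l h2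
    have e2 := hT l' h2'
    have e3 : l.1 = l'.1 := by
      apply mul_right_cancel₀ hne
      linear_combination he - e1 + e2
    have e4 : l.2 = l'.2 := by
      rw [e3] at e1
      linear_combination e1 - e2
    have : l = l' := Prod.ext e3 e4
    rw [this]

lemma sdz_arith (a b k n : ℝ) (hk : 2 ≤ k) (hka : k ≤ a) (hab : a ≤ b) (hn : 0 < n) (κ : ℝ)
    (hκ : κ * (k - 1) ≤ a * b) (hκ0 : 0 ≤ κ)
    (h : ((k - 1) * n) ^ 2 ≤ b * (2 * (a * n) * (2 * 10 ^ 8 * √(a * n) + 17 * a + 8 * κ))) :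
    n * k ^ 4 ≤ 10 ^ 20 * a ^ 3 * b ^ 2 := by
  have ha : 0 < a := by linarith
  have hb : 0 < b := by linarith
  have hk0 : 0 < k := by linarith
  have h1 : k ^ 2 * n ≤ 8 * a * b * (2 * 10 ^ 8 * √(a * n) + 17 * a + 8 * κ) := by
    have h2 : (k * n) ^ 2 ≤ 4 * ((k - 1) * n) ^ 2 := by
      have : k ^ 2 ≤ 4 * (k - 1) ^ 2 := by nlinarith
      have := mul_le_mul_of_nonneg_right this (sq_nonneg n)
      nlinarith
    refine le_of_mul_le_mul_right ?_ hn
    nlinarith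
  set s := √(a * n) with hs
  have hs0 : 0 ≤ s := Real.sqrt_nonneg _
  have hss : s ^ 2 = a * n := Real.sq_sqrt (by positivity)
  have hκ2 : κ * k ≤ 2 * (a * b) := by nlinarith
  rcases le_total (17 * a + 8 * κ) (2 * 10 ^ 8 * s) with hc | hc
  · have h3 : k ^ 2 * n ≤ 32 * 10 ^ 8 * (a * b) * s := by
      refine h1.trans ?_
      have : 8 * a * b * (2 * 10 ^ 8 * s + 17 * a + 8 * κ) ≤ 8 * a * b * (2 * 10 ^ 8 * s + 2 * 10 ^ 8 * s) :=
        mul_le_mul_of_nonneg_left (by linarith) (by positivity)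
      linarith
    have h4 : (k ^ 2 * n) ^ 2 ≤ (32 * 10 ^ 8 * (a * b) * s) ^ 2 := pow_le_pow_left₀ (by positivity) h3 2
    rw [mul_pow _ s, hss] at h4
    refine le_of_mul_le_mul_right ?_ hn
    have : 0 ≤ a ^ 3 * b ^ 2 * n := by positivity
    nlinarith
  · have h3 : k ^ 2 * n ≤ 16 * (a * b) * (17 * a + 8 * κ) := by
      refine h1.trans ?_
      have : 8 * a * b * (2 * 10 ^ 8 * s + 17 * a + 8 * κ) ≤ 8 * a * b * (2 * (17 * a + 8 * κ)) :=
        mul_le_mul_of_nonneg_left (by linarith) (by positivity)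
      linarith
    have h4 : k ^ 3 * n ≤ 16 * (a * b) * (33 * (a * b)) := by
      have h5 : (17 * a + 8 * κ) * k ≤ 33 * (a * b) := by nlinarith
      calc k ^ 3 * n = (k ^ 2 * n) * k := by ring
        _ ≤ 16 * (a * b) * (17 * a + 8 * κ) * k := mul_le_mul_of_nonneg_right h3 hk0.le
        _ = 16 * (a * b) * ((17 * a + 8 * κ) * k) := by ring
        _ ≤ _ := mul_le_mul_of_nonneg_left h5 (by positivity)
    calc n * k ^ 4 = (k ^ 3 * n) * k := by ring
      _ ≤ 16 * (a * b) * (33 * (a * b)) * k := mul_le_mul_of_nonneg_right h4 hk0.le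
      _ ≤ 16 * (a * b) * (33 * (a * b)) * a := mul_le_mul_of_nonneg_left hka (by positivity)
      _ ≤ _ := by
        have : 0 ≤ a ^ 3 * b ^ 2 := by positivity
        nlinarith

open Classical in
lemma sdz_sub (A B : Finset (ZMod p)) (hAB : A.card ≤ B.card) (k : ℕ) (hk : 2 ≤ k)
    (L : Finset (ZMod p × ZMod p)) (hL : ∀ l ∈ L, k ≤ inc A B l) (hp : 2 * (A.card * L.card) ≤ p * p) :
    (L.card : ℝ) * k ^ 4 ≤ 10 ^ 20 * (A.card : ℝ) ^ 3 * (B.card : ℝ) ^ 2 := by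
  rcases L.eq_empty_or_nonempty with rfl | ⟨l0, hl0⟩
  · simp; positivity
  have hka : k ≤ A.card := (hL l0 hl0).trans (inc_le _ _ _)
  have hn : 0 < L.card := Finset.card_pos.2 ⟨l0, hl0⟩
  set κ := A.card * B.card / (k - 1) with hκ
  have hk1 : 0 < k - 1 := by omega
  have hconc : ∀ x y : ZMod p, ∀ T ⊆ L, (∀ l ∈ T, l.1 * x + l.2 = y) → T.card ≤ κ := by
    intro x y T hT h
    rw [hκ, Nat.le_div_iff_mul_le hk1]
    exact rich_conc A B k T (fun l hl => hL l (hT hl)) x y h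
  set A0 := A.erase 0 with hA0
  have hA0c : A0.card ≤ A.card := Finset.card_erase_le
  have hen := energy p A0 L κ (by simp [hA0])
    ((Nat.mul_le_mul_left 2 (Nat.mul_le_mul_right _ hA0c)).trans hp) hconc
  set P := (A0 ×ˢ L).filter (fun x => x.2.1 * x.1 + x.2.2 ∈ B) with hP
  have hPc : (k - 1) * L.card ≤ P.card := by
    rw [Finset.card_eq_sum_card_fiberwise (f := Prod.snd) (t := L)
      (fun x hx => (Finset.mem_product.1 (Finset.mem_filter.1 hx).1).2), mul_comm, ← smul_eq_mul]
    refine Finset.card_nsmul_le_sum _ _ _ fun l hl => ?_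
    have h2 : inc A B l ≤ inc A0 B l + 1 := inc_erase A B l 0
    have h3 := hL l hl
    have h4 : inc A0 B l ≤ (P.filter (fun x => x.2 = l)).card := by
      refine Finset.card_le_card_of_injOn (fun a => (a, l)) ?_ ?_
      · intro a ha
        obtain ⟨h5, h6⟩ := Finset.mem_filter.1 ha
        exact Finset.mem_coe.2 (Finset.mem_filter.2 ⟨Finset.mem_filter.2 ⟨Finset.mem_product.2 ⟨h5, hl⟩, h6⟩, rfl⟩)
      · intro a _ a' _ h
        exact congrArg Prod.fst h
    exact le_trans (by omega : k - 1 ≤ inc A0 B l) h4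
  have hcs : P.card ^ 2 ≤ B.card * ((P ×ˢ P).filter
      (fun z => z.1.2.1 * z.1.1 + z.1.2.2 = z.2.2.1 * z.2.1 + z.2.2.2)).card := by
    convert cs P B (fun x => x.2.1 * x.1 + x.2.2) (fun x hx => (Finset.mem_filter.1 hx).2)
  have hsub : ((P ×ˢ P).filter (fun z => z.1.2.1 * z.1.1 + z.1.2.2 = z.2.2.1 * z.2.1 + z.2.2.2)).card ≤
      (((A0 ×ˢ L) ×ˢ (A0 ×ˢ L)).filter (fun z => z.1.2.1 * z.1.1 + z.1.2.2 = z.2.2.1 * z.2.1 + z.2.2.2)).card :=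
    Finset.card_le_card (Finset.filter_subset_filter _
      (Finset.product_subset_product (Finset.filter_subset _ _) (Finset.filter_subset _ _)))
  have hmain : ((k - 1) * L.card) ^ 2 ≤ B.card *
      (((A0 ×ˢ L) ×ˢ (A0 ×ˢ L)).filter (fun z => z.1.2.1 * z.1.1 + z.1.2.2 = z.2.2.1 * z.2.1 + z.2.2.2)).card :=
    (Nat.pow_le_pow_left hPc 2).trans (hcs.trans (Nat.mul_le_mul_left _ hsub))
  have hmr : (((k : ℝ) - 1) * L.card) ^ 2 ≤ B.card *
      (((A0 ×ˢ L) ×ˢ (A0 ×ˢ L)).filter (fun z => z.1.2.1 * z.1.1 + z.1.2.2 = z.2.2.1 * z.2.1 + z.2.2.2)).card := by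
    have : ((k : ℝ) - 1) = ((k - 1 : ℕ) : ℝ) := by push_cast [Nat.cast_sub (by omega : 1 ≤ k)]; ring
    rw [this]
    exact_mod_cast hmain
  have hAr : (A0.card : ℝ) ≤ A.card := by exact_mod_cast hA0c
  refine sdz_arith A.card B.card k L.card (by exact_mod_cast hk) (by exact_mod_cast hka)
    (by exact_mod_cast hAB) (by exact_mod_cast hn) κ ?_ (by positivity) (hmr.trans ?_)
  · have : ((k : ℝ) - 1) = ((k - 1 : ℕ) : ℝ) := by push_cast [Nat.cast_sub (by omega : 1 ≤ k)]; ring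
    rw [this]
    exact_mod_cast Nat.div_mul_le_self _ _
  · refine mul_le_mul_of_nonneg_left (hen.trans ?_) (by positivity)
    gcongr

open Classical in
theorem sdz (A B : Finset (ZMod p)) (hAB : A.card ≤ B.card) (k : ℕ) (hk : 2 ≤ k)
    (hp : 4 * 10 ^ 20 * (A.card : ℝ) ^ 4 * (B.card : ℝ) ^ 2 ≤ (p : ℝ) ^ 2 * k ^ 4) :
    ((univ.filter (fun l : ZMod p × ZMod p => k ≤ inc A B l)).card : ℝ) * k ^ 4 ≤
      10 ^ 20 * (A.card : ℝ) ^ 3 * (B.card : ℝ) ^ 2 := by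
  set L := univ.filter (fun l : ZMod p × ZMod p => k ≤ inc A B l) with hL
  by_contra hcon
  push Not at hcon
  have hk0 : (0 : ℝ) < k := by positivity
  have hka : k ≤ A.card := by
    rcases L.eq_empty_or_nonempty with h | ⟨l0, hl0⟩
    · rw [h] at hcon
      simp only [Finset.card_empty, Nat.cast_zero, zero_mul] at hcon
      exact absurd hcon (not_lt.2 (by positivity))
    · exact (Finset.mem_filter.1 hl0).2.trans (inc_le _ _ _)
  have hkr : (k : ℝ) ≤ A.card := by exact_mod_cast hka
  have hABr : (A.card : ℝ) ≤ B.card := by exact_mod_cast hAB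
  set y : ℝ := 10 ^ 20 * (A.card : ℝ) ^ 3 * (B.card : ℝ) ^ 2 with hy
  have hyk : (k : ℝ) ^ 4 ≤ y := by
    have h1 : (k : ℝ) ^ 3 ≤ (A.card : ℝ) ^ 3 := pow_le_pow_left₀ hk0.le hkr 3
    have h2 : (k : ℝ) ^ 2 ≤ (B.card : ℝ) ^ 2 := pow_le_pow_left₀ hk0.le (hkr.trans hABr) 2
    have h3 : (k : ℝ) ≤ k ^ 2 := by
      have : (2 : ℝ) ≤ k := by exact_mod_cast hk
      nlinarith
    calc (k : ℝ) ^ 4 = k ^ 3 * k := by ring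
      _ ≤ (A.card : ℝ) ^ 3 * (B.card : ℝ) ^ 2 := mul_le_mul h1 (h3.trans h2) hk0.le (by positivity)
      _ ≤ y := by
        have : 0 ≤ (A.card : ℝ) ^ 3 * (B.card : ℝ) ^ 2 := by positivity
        rw [hy]; nlinarith
  set n := ⌊y / k ^ 4⌋₊ + 1 with hn
  have hn1 : y / k ^ 4 < n := by rw [hn]; push_cast; exact Nat.lt_floor_add_one _
  have hn2 : (n : ℝ) ≤ y / k ^ 4 + 1 := by
    rw [hn]; push_cast
    have := Nat.floor_le (by positivity : 0 ≤ y / (k : ℝ) ^ 4)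
    linarith
  have hk4 : (0 : ℝ) < k ^ 4 := by positivity
  have hnL : n ≤ L.card := by
    rw [hn, Nat.succ_le_iff, Nat.floor_lt (by positivity), div_lt_iff₀ hk4]
    exact hcon
  obtain ⟨L', hL', hL'c⟩ := Finset.exists_subset_card_eq hnL
  have hsub := sdz_sub A B hAB k hk L' (fun l hl => (Finset.mem_filter.1 (hL' hl)).2) (by
    rw [hL'c]
    have h1 : (n : ℝ) * k ^ 4 ≤ 2 * y := by
      have := mul_le_mul_of_nonneg_right hn2 hk4.le
      rw [add_mul, div_mul_cancel₀ _ hk4.ne'] at this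
      linarith
    have h2 : (2 * (A.card * n) : ℝ) ≤ p * p := by
      refine le_of_mul_le_mul_right ?_ hk4
      calc (2 * (A.card * n) : ℝ) * k ^ 4 = 2 * A.card * (n * k ^ 4) := by ring
        _ ≤ 2 * A.card * (2 * y) := mul_le_mul_of_nonneg_left h1 (by positivity)
        _ = 4 * 10 ^ 20 * (A.card : ℝ) ^ 4 * (B.card : ℝ) ^ 2 := by rw [hy]; ring
        _ ≤ _ := hp
        _ = _ := by ring
    exact_mod_cast h2)
  rw [hL'c] at hsub
  rw [div_lt_iff₀ hk4] at hn1
  linarith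

end Sdz
end DS


namespace DS
section Vinh
variable {p : ℕ} [Fact p.Prime]

open Classical in
lemma inc_eq (A B : Finset (ZMod p)) (l : ZMod p × ZMod p) :
    inc A B l = ∑ x ∈ A, if l.1 * x + l.2 ∈ B then 1 else 0 := by
  unfold inc; rw [Finset.card_filter]

open Classical in
lemma lines_pt (B : Finset (ZMod p)) (x : ZMod p) :
    (univ.filter (fun l : ZMod p × ZMod p => l.1 * x + l.2 ∈ B)).card = p * B.card := by
  have h : p * B.card = ((univ : Finset (ZMod p)) ×ˢ B).card := by
    rw [Finset.card_product, Finset.card_univ, ZMod.card]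
  rw [h]
  refine Finset.card_bij' (fun l _ => (l.1, l.1 * x + l.2)) (fun z _ => (z.1, z.2 - z.1 * x)) ?_ ?_ ?_ ?_
  · intro l hl; simpa using hl
  · intro z hz; simpa using hz
  · intro l hl; simp
  · intro z hz; simp

open Classical in
lemma lines_two (B : Finset (ZMod p)) (x y : ZMod p) (hxy : x ≠ y) :
    (univ.filter (fun l : ZMod p × ZMod p => l.1 * x + l.2 ∈ B ∧ l.1 * y + l.2 ∈ B)).card ≤ B.card ^ 2 := by
  rw [sq, ← Finset.card_product]
  refine Finset.card_le_card_of_injOn (fun l => (l.1 * x + l.2, l.1 * y + l.2)) ?_ ?_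
  · intro l hl
    exact Finset.mem_coe.2 (Finset.mem_product.2 (Finset.mem_filter.1 hl).2)
  · intro l _ l' _ h
    simp only [Prod.mk.injEq] at h
    have e : l.1 = l'.1 := by
      apply mul_right_cancel₀ (sub_ne_zero.2 hxy)
      linear_combination h.1 - h.2
    refine Prod.ext e ?_
    have := h.1
    rw [e] at this
    exact add_left_cancel this

open Classical in
lemma sum_inc (A B : Finset (ZMod p)) : ∑ l : ZMod p × ZMod p, inc A B l = p * (A.card * B.card) := by
  simp_rw [inc_eq]
  rw [Finset.sum_comm]
  have : ∀ x ∈ A, (∑ l : ZMod p × ZMod p, if l.1 * x + l.2 ∈ B then 1 else 0) = p * B.card := by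
    intro x _
    rw [← Finset.card_filter, lines_pt]
  rw [Finset.sum_congr rfl this, Finset.sum_const, smul_eq_mul]
  ring

open Classical in
lemma sum_inc_sq (A B : Finset (ZMod p)) : ∑ l : ZMod p × ZMod p, inc A B l ^ 2 ≤
    p * (A.card * B.card) + A.card ^ 2 * B.card ^ 2 := by
  have h1 : ∀ l : ZMod p × ZMod p, inc A B l ^ 2 =
      ∑ x ∈ A, ∑ y ∈ A, if l.1 * x + l.2 ∈ B ∧ l.1 * y + l.2 ∈ B then 1 else 0 := by
    intro l
    rw [sq, inc_eq, Finset.sum_mul_sum]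
    refine Finset.sum_congr rfl fun x _ => Finset.sum_congr rfl fun y _ => ?_
    by_cases hx : l.1 * x + l.2 ∈ B <;> by_cases hy : l.1 * y + l.2 ∈ B <;> simp [hx, hy]
  simp_rw [h1]
  rw [Finset.sum_comm]
  have h2 : ∀ x ∈ A, (∑ l : ZMod p × ZMod p, ∑ y ∈ A,
      if l.1 * x + l.2 ∈ B ∧ l.1 * y + l.2 ∈ B then 1 else 0) ≤ p * B.card + A.card * B.card ^ 2 := by
    intro x hx
    rw [Finset.sum_comm]
    have h3 : ∀ y ∈ A, (∑ l : ZMod p × ZMod p, if l.1 * x + l.2 ∈ B ∧ l.1 * y + l.2 ∈ B then 1 else 0) ≤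
        (if y = x then p * B.card else 0) + B.card ^ 2 := by
      intro y _
      rw [← Finset.card_filter]
      by_cases hxy : y = x
      · subst hxy
        simp only [and_self, if_true]
        rw [lines_pt]; omega
      · rw [if_neg hxy, zero_add]
        exact lines_two B x y (Ne.symm hxy)
    refine (Finset.sum_le_sum h3).trans ?_
    rw [Finset.sum_add_distrib, Finset.sum_ite_eq' A x, if_pos hx, Finset.sum_const, smul_eq_mul]
  refine (Finset.sum_le_sum h2).trans ?_
  rw [Finset.sum_const, smul_eq_mul]
  exact le_of_eq (by ring)

lemma vinh (A B : Finset (ZMod p)) :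
    ∑ l : ZMod p × ZMod p, ((inc A B l : ℝ) - A.card * B.card / p) ^ 2 ≤ p * (A.card * B.card) := by
  have hp : (p : ℝ) ≠ 0 := by exact_mod_cast (Fact.out : p.Prime).ne_zero
  have h1 : (∑ l : ZMod p × ZMod p, (inc A B l : ℝ)) = p * (A.card * B.card) := by
    exact_mod_cast sum_inc A B
  have h2 : (∑ l : ZMod p × ZMod p, (inc A B l : ℝ) ^ 2) ≤
      p * (A.card * B.card) + A.card ^ 2 * B.card ^ 2 := by
    exact_mod_cast sum_inc_sq A B
  have h3 : ∀ l : ZMod p × ZMod p, ((inc A B l : ℝ) - A.card * B.card / p) ^ 2 =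
      (inc A B l : ℝ) ^ 2 - (2 * (A.card * B.card / p)) * inc A B l + (A.card * B.card / p) ^ 2 := by
    intro l; ring
  simp_rw [h3]
  rw [Finset.sum_add_distrib, Finset.sum_sub_distrib, ← Finset.mul_sum, h1, Finset.sum_const,
    Finset.card_univ, Fintype.card_prod, ZMod.card, nsmul_eq_mul]
  push_cast
  have : (p : ℝ) * p * (A.card * B.card / p) ^ 2 = A.card ^ 2 * B.card ^ 2 := by field_simp
  rw [this]
  have : 2 * ((A.card : ℝ) * B.card / p) * (p * (A.card * B.card)) = 2 * (A.card ^ 2 * B.card ^ 2) := by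
    field_simp
  rw [this]
  linarith

open Classical in
lemma high_sq (A B : Finset (ZMod p)) (τ : ℝ) (hτ : 2 * (A.card * B.card / p) ≤ τ) :
    ∑ l ∈ univ.filter (fun l : ZMod p × ZMod p => τ < inc A B l), (inc A B l : ℝ) ^ 2 ≤
      4 * (p * (A.card * B.card)) := by
  have h1 : ∀ l ∈ univ.filter (fun l : ZMod p × ZMod p => τ < inc A B l), (inc A B l : ℝ) ^ 2 ≤
      4 * ((inc A B l : ℝ) - A.card * B.card / p) ^ 2 := by
    intro l hl
    have h2 := (Finset.mem_filter.1 hl).2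
    have h3 : (inc A B l : ℝ) ≤ 2 * ((inc A B l : ℝ) - A.card * B.card / p) := by linarith
    have := pow_le_pow_left₀ (by positivity) h3 2
    linarith
  refine (Finset.sum_le_sum h1).trans ?_
  rw [← Finset.mul_sum]
  refine mul_le_mul_of_nonneg_left (le_trans ?_ (vinh A B)) (by norm_num)
  exact Finset.sum_le_univ_sum_of_nonneg fun l => sq_nonneg _

open Classical in
lemma dyadic (A B : Finset (ZMod p)) (C : ℝ) (K0 : ℕ) (hK0 : 1 ≤ K0) (hC : 0 ≤ C)
    (h : ∀ k : ℕ, K0 ≤ k → ((univ.filter (fun l : ZMod p × ZMod p => k ≤ inc A B l)).card : ℝ) * k ^ 4 ≤ C) :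
    ∀ n K : ℕ, K0 ≤ K → A.card < K + n →
    (∑ l ∈ univ.filter (fun l : ZMod p × ZMod p => K ≤ inc A B l), (inc A B l : ℝ) ^ 3) * K ≤ 16 * C := by
  intro n
  induction n using Nat.strong_induction_on with
  | _ n ih =>
    intro K hK hn
    have hKpos : (0 : ℝ) < K := by exact_mod_cast (hK0.trans hK)
    rcases Nat.eq_zero_or_pos n with rfl | hnpos
    · have : univ.filter (fun l : ZMod p × ZMod p => K ≤ inc A B l) = ∅ := by
        apply Finset.filter_eq_empty_iff.2
        intro l _ h
        have := inc_le A B l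
        omega
      rw [this]; simp; exact hC
    · have h2 := ih (n - 1) (by omega) (2 * K) (by omega) (by omega)
      have h3 := h K hK
      have hsplit : ∑ l ∈ univ.filter (fun l : ZMod p × ZMod p => K ≤ inc A B l), (inc A B l : ℝ) ^ 3 ≤
          (univ.filter (fun l : ZMod p × ZMod p => K ≤ inc A B l)).card * (8 * K ^ 3) +
          ∑ l ∈ univ.filter (fun l : ZMod p × ZMod p => 2 * K ≤ inc A B l), (inc A B l : ℝ) ^ 3 := by
        rw [← Finset.sum_filter_add_sum_filter_not _ (fun l : ZMod p × ZMod p => 2 * K ≤ inc A B l), add_comm]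
        refine add_le_add ?_ ?_
        · calc _ ≤ ∑ l ∈ (univ.filter (fun l : ZMod p × ZMod p => K ≤ inc A B l)).filter
                (fun l => ¬ 2 * K ≤ inc A B l), (8 * (K : ℝ) ^ 3) := by
                refine Finset.sum_le_sum fun l hl => ?_
                have h5 := (Finset.mem_filter.1 hl).2
                have h6 : (inc A B l : ℝ) ≤ 2 * K := by
                  have : inc A B l ≤ 2 * K := by omega
                  exact_mod_cast this
                have := pow_le_pow_left₀ (by positivity) h6 3
                linarith
            _ ≤ _ := by
                rw [Finset.sum_const, nsmul_eq_mul]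
                refine mul_le_mul_of_nonneg_right ?_ (by positivity)
                exact_mod_cast Finset.card_filter_le _ _
        · refine Finset.sum_le_sum_of_subset_of_nonneg ?_ fun _ _ _ => by positivity
          intro l hl
          exact Finset.mem_filter.2 ⟨Finset.mem_univ _, (Finset.mem_filter.1 hl).2⟩
      push_cast at h2
      have := mul_le_mul_of_nonneg_right hsplit hKpos.le
      nlinarith

/-- total cube weight of rich lines -/
lemma rich_cubes_arith (a b p k : ℝ) (hp : 0 < p) (hk : k = 2 * 10 ^ 5 * (a * √b / √p)) (hb : 0 ≤ b) :
    p ^ 2 * k ^ 4 = 16 * 10 ^ 20 * a ^ 4 * b ^ 2 := by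
  have h1 : √b ^ 4 = b ^ 2 := by
    rw [show √b ^ 4 = (√b ^ 2) ^ 2 by ring, Real.sq_sqrt hb]
  have h2 : √p ^ 4 = p ^ 2 := by
    rw [show √p ^ 4 = (√p ^ 2) ^ 2 by ring, Real.sq_sqrt hp.le]
  rw [hk, mul_pow, div_pow, mul_pow a, h1, h2]
  field_simp
  norm_num
  ring

open Classical in
theorem rich_cubes (A B : Finset (ZMod p)) (hAB : A.card ≤ B.card) (hA : 0 < A.card) (τ : ℝ)
    (hτ4 : 4 ≤ τ) (hτ : 2 * (A.card * B.card / p) ≤ τ) :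
    ∑ l ∈ univ.filter (fun l : ZMod p × ZMod p => τ < inc A B l), (inc A B l : ℝ) ^ 3 ≤
      10 ^ 16 * (√p * (A.card : ℝ) ^ 2 * (B.card * √B.card)) := by
  have hp : (0 : ℝ) < p := by exact_mod_cast (Fact.out : p.Prime).pos
  have ha : (0 : ℝ) < A.card := by exact_mod_cast hA
  have hb : (0 : ℝ) < B.card := by exact_mod_cast hA.trans_le hAB
  have hsp : 0 < √(p : ℝ) := Real.sqrt_pos.2 hp
  have hsb : 0 < √(B.card : ℝ) := Real.sqrt_pos.2 hb
  have hspp : √(p : ℝ) * √p = p := Real.mul_self_sqrt hp.le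
  have hsbb : √(B.card : ℝ) * √B.card = B.card := Real.mul_self_sqrt hb.le
  set k1 : ℝ := 2 * 10 ^ 5 * (A.card * √B.card / √p) with hk1
  have hk1pos : 0 < k1 := by positivity
  set K : ℕ := ⌊k1⌋₊ + 2 with hK
  have hKk : k1 ≤ K := by
    rw [hK]; push_cast
    have := (Nat.lt_floor_add_one k1).le
    linarith
  have hKk2 : (K : ℝ) ≤ k1 + 2 := by
    rw [hK]; push_cast
    have := Nat.floor_le hk1pos.le
    linarith
  have har := rich_cubes_arith A.card B.card p k1 hp hk1 hb.le
  -- the very rich lines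
  have hF := dyadic A B (10 ^ 20 * (A.card : ℝ) ^ 3 * (B.card : ℝ) ^ 2) K (by omega) (by positivity)
    (fun k hk => sdz A B hAB k (by omega) (by
      have h1 : k1 ≤ k := hKk.trans (by exact_mod_cast hk)
      have h2 : k1 ^ 4 ≤ (k : ℝ) ^ 4 := pow_le_pow_left₀ hk1pos.le h1 4
      have h3 := mul_le_mul_of_nonneg_left h2 (sq_nonneg (p : ℝ))
      rw [har] at h3
      refine le_trans ?_ h3
      gcongr
      norm_num)) (A.card + 1) K le_rfl (by omega)
  set F := ∑ l ∈ univ.filter (fun l : ZMod p × ZMod p => K ≤ inc A B l), (inc A B l : ℝ) ^ 3 with hFd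
  have hF0 : 0 ≤ F := Finset.sum_nonneg fun _ _ => by positivity
  set Q := √p * (A.card : ℝ) ^ 2 * (B.card * √B.card) with hQ
  have hQ0 : 0 ≤ Q := by positivity
  have hFQ : F ≤ 8 * 10 ^ 15 * Q := by
    have h1 : F * k1 ≤ 16 * (10 ^ 20 * (A.card : ℝ) ^ 3 * (B.card : ℝ) ^ 2) :=
      (mul_le_mul_of_nonneg_left hKk hF0).trans hF
    refine le_of_mul_le_mul_right (h1.trans (le_of_eq ?_)) hk1pos
    rw [hQ, hk1]
    field_simp
    rw [Real.sq_sqrt hb.le]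
    ring
  -- moderately rich lines
  have hM : ∑ l ∈ (univ.filter (fun l : ZMod p × ZMod p => τ < inc A B l)).filter
      (fun l => ¬ K ≤ inc A B l), (inc A B l : ℝ) ^ 3 ≤ 16 * 10 ^ 5 * Q := by
    have h1 : ∀ l ∈ (univ.filter (fun l : ZMod p × ZMod p => τ < inc A B l)).filter
      (fun l => ¬ K ≤ inc A B l), (inc A B l : ℝ) ^ 3 ≤ 2 * k1 * (inc A B l : ℝ) ^ 2 := by
      intro l hl
      obtain ⟨h2, h3⟩ := Finset.mem_filter.1 hl
      have h4 := (Finset.mem_filter.1 h2).2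
      have h5 : (inc A B l : ℝ) + 1 ≤ K := by
        have : inc A B l + 1 ≤ K := by omega
        exact_mod_cast this
      have h6 : (inc A B l : ℝ) ≤ 2 * k1 := by linarith
      have := mul_le_mul_of_nonneg_right h6 (sq_nonneg (inc A B l : ℝ))
      calc (inc A B l : ℝ) ^ 3 = inc A B l * (inc A B l : ℝ) ^ 2 := by ring
        _ ≤ _ := this
    refine (Finset.sum_le_sum h1).trans ?_
    rw [← Finset.mul_sum]
    have h2 := (Finset.sum_le_sum_of_subset_of_nonneg (f := fun l : ZMod p × ZMod p => (inc A B l : ℝ) ^ 2)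
      (Finset.filter_subset (fun l => ¬ K ≤ inc A B l)
      (univ.filter (fun l : ZMod p × ZMod p => τ < inc A B l))) (fun _ _ _ => by positivity)).trans
      (high_sq A B τ hτ)
    refine (mul_le_mul_of_nonneg_left h2 (by positivity)).trans (le_of_eq ?_)
    rw [hQ, hk1]
    field_simp
    rw [Real.sq_sqrt hp.le]
    ring
  rw [← Finset.sum_filter_add_sum_filter_not _ (fun l : ZMod p × ZMod p => K ≤ inc A B l)]
  have hV : ∑ l ∈ (univ.filter (fun l : ZMod p × ZMod p => τ < inc A B l)).filter
      (fun l => K ≤ inc A B l), (inc A B l : ℝ) ^ 3 ≤ F := by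
    refine Finset.sum_le_sum_of_subset_of_nonneg ?_ fun _ _ _ => by positivity
    intro l hl
    exact Finset.mem_filter.2 ⟨Finset.mem_univ _, (Finset.mem_filter.1 hl).2⟩
  linarith

end Vinh
end DS

namespace DS
section Final
variable {p : ℕ} [Fact p.Prime]

/-- line through two points with different abscissae -/
def lf (z : (ZMod p × ZMod p) × (ZMod p × ZMod p)) : ZMod p × ZMod p :=
  ((z.1.2 - z.2.2) / (z.1.1 - z.2.1), z.1.2 - (z.1.2 - z.2.2) / (z.1.1 - z.2.1) * z.1.1)

lemma lf_fst (z : (ZMod p × ZMod p) × (ZMod p × ZMod p)) :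
    (lf z).1 * z.1.1 + (lf z).2 = z.1.2 := by simp [lf]

lemma lf_snd (z : (ZMod p × ZMod p) × (ZMod p × ZMod p)) (h : z.1.1 ≠ z.2.1) :
    (lf z).1 * z.2.1 + (lf z).2 = z.2.2 := by
  have := sub_ne_zero.2 h
  simp only [lf]
  field_simp
  ring

open Classical in
noncomputable def Wt (A B A' B' : Finset (ZMod p)) :
    Finset (((ZMod p × ZMod p) × (ZMod p × ZMod p)) × (ZMod p × ZMod p)) :=
  (((A ×ˢ B) ×ˢ (A' ×ˢ B')) ×ˢ (A' ×ˢ B')).filter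
    (fun z => z.1.1.1 ≠ z.1.2.1 ∧ (lf z.1).1 * z.2.1 + (lf z.1).2 = z.2.2)

open Classical in
lemma Wt_low (A B A' B' : Finset (ZMod p)) (τ : ℝ) (hτ : 0 ≤ τ) :
    (((Wt A B A' B').filter (fun z => ¬ τ < inc A' B' (lf z.1))).card : ℝ) ≤
      τ * ((A.card * B.card) * (A'.card * B'.card)) := by
  have h := Finset.card_le_mul_card_image_of_maps_to (s := (Wt A B A' B').filter (fun z => ¬ τ < inc A' B' (lf z.1)))
    (t := (A ×ˢ B) ×ˢ (A' ×ˢ B')) (f := Prod.fst) (fun z hz =>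
      (Finset.mem_product.1 (Finset.mem_filter.1 (Finset.mem_filter.1 hz).1).1).1) ⌊τ⌋₊ (by
      intro u _
      by_cases hu : τ < inc A' B' (lf u)
      · have : ((Wt A B A' B').filter (fun z => ¬ τ < inc A' B' (lf z.1))).filter (fun z => z.1 = u) = ∅ := by
          apply Finset.filter_eq_empty_iff.2
          intro z hz he
          apply (Finset.mem_filter.1 hz).2
          rw [he]; exact hu
        rw [this]; simp
      · refine le_trans ?_ (Nat.le_floor (not_lt.1 hu))
        refine Finset.card_le_card_of_injOn (fun z => z.2.1) ?_ ?_
        · intro z hz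
          obtain ⟨h1, h2⟩ := Finset.mem_filter.1 hz
          obtain ⟨h3, h4⟩ := Finset.mem_filter.1 h1
          obtain ⟨h5, h6, h7⟩ := Finset.mem_filter.1 h3
          have h8 := (Finset.mem_product.1 (Finset.mem_product.1 h5).2)
          rw [h2] at h7
          refine Finset.mem_coe.2 (Finset.mem_filter.2 ⟨h8.1, ?_⟩)
          simp only
          rw [h7]; exact h8.2
        · intro z hz z' hz' he
          obtain ⟨h1, h2⟩ := Finset.mem_filter.1 hz
          obtain ⟨h3, h4⟩ := Finset.mem_filter.1 h1
          obtain ⟨h5, h6, h7⟩ := Finset.mem_filter.1 h3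
          obtain ⟨h1', h2'⟩ := Finset.mem_filter.1 hz'
          obtain ⟨h3', h4'⟩ := Finset.mem_filter.1 h1'
          obtain ⟨h5', h6', h7'⟩ := Finset.mem_filter.1 h3'
          simp only at he
          refine Prod.ext (h2.trans h2'.symm) (Prod.ext he ?_)
          rw [← h7, ← h7', h2, h2', he])
  have h2 : ((((Wt A B A' B').filter (fun z => ¬ τ < inc A' B' (lf z.1))).card : ℕ) : ℝ) ≤
      ((⌊τ⌋₊ * ((A ×ˢ B) ×ˢ (A' ×ˢ B')).card : ℕ) : ℝ) := by exact_mod_cast h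
  refine h2.trans ?_
  rw [Finset.card_product, Finset.card_product, Finset.card_product]
  push_cast
  exact mul_le_mul_of_nonneg_right (Nat.floor_le hτ) (by positivity)

open Classical in
lemma Wt_high (A B A' B' : Finset (ZMod p)) (τ : ℝ) :
    (((Wt A B A' B').filter (fun z => τ < inc A' B' (lf z.1))).card : ℝ) ≤
      ∑ l ∈ univ.filter (fun l : ZMod p × ZMod p => τ < inc A' B' l), (inc A B l : ℝ) * (inc A' B' l : ℝ) ^ 2 := by
  have h : ((Wt A B A' B').filter (fun z => τ < inc A' B' (lf z.1))).card ≤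
      ∑ l ∈ univ.filter (fun l : ZMod p × ZMod p => τ < inc A' B' l), inc A B l * inc A' B' l ^ 2 := by
    rw [Finset.card_eq_sum_card_fiberwise (f := fun z : ((ZMod p × ZMod p) × (ZMod p × ZMod p)) × (ZMod p × ZMod p) => lf z.1)
      (t := univ.filter (fun l : ZMod p × ZMod p => τ < inc A' B' l))
      (fun z hz => Finset.mem_coe.2 (Finset.mem_filter.2 ⟨Finset.mem_univ _, (Finset.mem_filter.1 hz).2⟩))]
    refine Finset.sum_le_sum fun l _ => ?_
    unfold inc
    rw [sq, ← Finset.card_product, ← Finset.card_product]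
    refine Finset.card_le_card_of_injOn (fun z => (z.1.1.1, z.1.2.1, z.2.1)) ?_ ?_
    · intro z hz
      obtain ⟨h1, h2⟩ := Finset.mem_filter.1 hz
      obtain ⟨h3, h4⟩ := Finset.mem_filter.1 h1
      obtain ⟨h5, h6, h7⟩ := Finset.mem_filter.1 h3
      obtain ⟨m1, m2⟩ := Finset.mem_product.1 h5
      obtain ⟨m3, m4⟩ := Finset.mem_product.1 m1
      rw [Finset.mem_product] at m2 m3 m4
      have e1 := lf_fst z.1
      have e2 := lf_snd z.1 h6
      rw [h2] at e1 e2 h7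
      refine Finset.mem_coe.2 (Finset.mem_product.2 ⟨Finset.mem_filter.2 ⟨m3.1, ?_⟩,
        Finset.mem_product.2 ⟨Finset.mem_filter.2 ⟨m4.1, ?_⟩, Finset.mem_filter.2 ⟨m2.1, ?_⟩⟩⟩)
      · simp only; rw [e1]; exact m3.2
      · simp only; rw [e2]; exact m4.2
      · simp only; rw [h7]; exact m2.2
    · intro z hz z' hz' he
      obtain ⟨h1, h2⟩ := Finset.mem_filter.1 hz
      obtain ⟨h3, h4⟩ := Finset.mem_filter.1 h1
      obtain ⟨h5, h6, h7⟩ := Finset.mem_filter.1 h3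
      obtain ⟨h1', h2'⟩ := Finset.mem_filter.1 hz'
      obtain ⟨h3', h4'⟩ := Finset.mem_filter.1 h1'
      obtain ⟨h5', h6', h7'⟩ := Finset.mem_filter.1 h3'
      have e1 := lf_fst z.1
      have e2 := lf_snd z.1 h6
      have e1' := lf_fst z'.1
      have e2' := lf_snd z'.1 h6'
      rw [h2] at e1 e2 h7
      rw [h2'] at e1' e2' h7'
      simp only [Prod.mk.injEq] at he
      obtain ⟨k1, k2, k3⟩ := he
      refine Prod.ext (Prod.ext (Prod.ext k1 ?_) (Prod.ext k2 ?_)) (Prod.ext k3 ?_)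
      · rw [← e1, ← e1', k1]
      · rw [← e2, ← e2', k2]
      · rw [← h7, ← h7', k3]
  exact_mod_cast h

open Classical in
theorem Wt_bound (A B A' B' : Finset (ZMod p)) (hAB : A.card ≤ B.card) (hA : 0 < A.card)
    (hA' : A'.card = A.card) (hB' : B'.card = B.card) :
    ((Wt A B A' B').card : ℝ) ≤ 10 ^ 17 * (√p * (A.card : ℝ) ^ 2 * (B.card * √B.card)) +
      2 * ((A.card : ℝ) ^ 3 * B.card ^ 3 / p) := by
  have hp : (0 : ℝ) < p := by exact_mod_cast (Fact.out : p.Prime).pos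
  set τ : ℝ := 4 + 2 * (A.card * B.card / p) with hτ
  have hτ0 : 0 ≤ 2 * ((A.card : ℝ) * B.card / p) := by positivity
  have hlow := Wt_low A B A' B' τ (by linarith)
  have hhigh := Wt_high A B A' B' τ
  have c1 := rich_cubes A B hAB hA τ (by linarith) (by linarith)
  have c2 := rich_cubes A' B' (by omega) (by omega) τ (by linarith) (by rw [hA', hB']; linarith)
  rw [hA', hB'] at c2 hlow
  set Q := √p * (A.card : ℝ) ^ 2 * (B.card * √B.card) with hQ
  have hcub : ∑ l ∈ univ.filter (fun l : ZMod p × ZMod p => τ < inc A' B' l), (inc A B l : ℝ) * (inc A' B' l : ℝ) ^ 2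
      ≤ ∑ l ∈ univ.filter (fun l : ZMod p × ZMod p => τ < inc A' B' l), (inc A' B' l : ℝ) ^ 3 +
        ∑ l ∈ univ.filter (fun l : ZMod p × ZMod p => τ < inc A B l), (inc A B l : ℝ) ^ 3 := by
    rw [← Finset.sum_filter_add_sum_filter_not _ (fun l : ZMod p × ZMod p => inc A B l ≤ inc A' B' l)]
    refine add_le_add ?_ ?_
    · refine le_trans (Finset.sum_le_sum (g := fun l => (inc A' B' l : ℝ) ^ 3) fun l hl => ?_)
        (Finset.sum_le_sum_of_subset_of_nonneg (Finset.filter_subset _ _) fun _ _ _ => by positivity)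
      have h1 : (inc A B l : ℝ) ≤ inc A' B' l := by exact_mod_cast (Finset.mem_filter.1 hl).2
      have := mul_le_mul_of_nonneg_right h1 (sq_nonneg (inc A' B' l : ℝ))
      calc _ ≤ _ := this
        _ = _ := by ring
    · refine le_trans (Finset.sum_le_sum (g := fun l => (inc A B l : ℝ) ^ 3) fun l hl => ?_)
        (Finset.sum_le_sum_of_subset_of_nonneg ?_ fun _ _ _ => by positivity)
      · have h1 : (inc A' B' l : ℝ) ≤ inc A B l := by
          exact_mod_cast (not_le.1 (Finset.mem_filter.1 hl).2).le
        have := mul_le_mul_of_nonneg_left (pow_le_pow_left₀ (by positivity) h1 2) (by positivity : (0 : ℝ) ≤ inc A B l)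
        calc _ ≤ _ := this
          _ = _ := by ring
      · intro l hl
        obtain ⟨h1, h2⟩ := Finset.mem_filter.1 hl
        refine Finset.mem_filter.2 ⟨Finset.mem_univ _, (Finset.mem_filter.1 h1).2.trans ?_⟩
        exact_mod_cast not_le.1 h2
  have hsplit : ((Wt A B A' B').card : ℝ) =
      ((Wt A B A' B').filter (fun z => τ < inc A' B' (lf z.1))).card +
      ((Wt A B A' B').filter (fun z => ¬ τ < inc A' B' (lf z.1))).card := by
    exact_mod_cast (Finset.card_filter_add_card_filter_not (s := Wt A B A' B')
      (fun z => τ < inc A' B' (lf z.1))).symm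
  have hb : (0 : ℝ) ≤ B.card := by positivity
  have hBp : √(B.card : ℝ) ≤ √p := by
    apply Real.sqrt_le_sqrt
    have := Finset.card_le_univ B
    rw [ZMod.card] at this
    exact_mod_cast this
  have h4 : 4 * (((A.card : ℝ) * B.card) * (A.card * B.card)) ≤ 4 * Q := by
    have h5 : (B.card : ℝ) = √B.card * √B.card := (Real.mul_self_sqrt hb).symm
    have h6 : √(B.card : ℝ) * √B.card ≤ √p * √B.card := mul_le_mul_of_nonneg_right hBp (Real.sqrt_nonneg _)
    rw [← h5] at h6
    have h7 := mul_le_mul_of_nonneg_left h6 (mul_nonneg (sq_nonneg (A.card : ℝ)) hb)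
    rw [hQ]
    linarith
  have hQ0 : 0 ≤ Q := by positivity
  have h8 : 2 * ((A.card : ℝ) * B.card / p) * (((A.card : ℝ) * B.card) * (A.card * B.card)) =
      2 * ((A.card : ℝ) ^ 3 * B.card ^ 3 / p) := by ring
  rw [hτ, add_mul, h8] at hlow
  rw [← hτ] at hlow
  linarith

open Classical in
lemma Dstar_le (A B : Finset (ZMod p)) (lam mu : ZMod p) (hl : lam ≠ 0) (hm : mu ≠ 0) :
    Dstar A B lam mu ≤ (A.card * B.card) *
      (Wt A B (A.image (fun x => lam * x)) (B.image (fun x => mu * x))).card := by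
  set f : (ZMod p × ZMod p) × (ZMod p × ZMod p) → ZMod p :=
    fun s => (s.1.1 - lam * s.2.1) * (s.1.2 - mu * s.2.2) with hf
  set S := ((A ×ˢ B) ×ˢ (A ×ˢ B)).filter (fun s => f s ≠ 0) with hS
  have h1 : Dstar A B lam mu ≤ ((S ×ˢ S).filter (fun z => f z.1 = f z.2)).card := by
    unfold Dstar
    rw [← Finset.card_univ]
    refine Finset.card_le_card_of_injOn
      (fun t => (((t.1.1.1, t.1.2.1), (t.1.1.2.1, t.1.2.2.1)), ((t.1.1.2.2.1, t.1.2.2.2.1), (t.1.1.2.2.2, t.1.2.2.2.2)))) ?_ ?_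
    · rintro ⟨t, a1, a2, a3, a4, b1, b2, b3, b4, he, hn⟩ _
      refine Finset.mem_coe.2 (Finset.mem_filter.2 ⟨Finset.mem_product.2 ⟨?_, ?_⟩, he⟩)
      · exact Finset.mem_filter.2 ⟨Finset.mem_product.2 ⟨Finset.mem_product.2 ⟨a1, b1⟩, Finset.mem_product.2 ⟨a2, b2⟩⟩, hn⟩
      · refine Finset.mem_filter.2 ⟨Finset.mem_product.2 ⟨Finset.mem_product.2 ⟨a3, b3⟩, Finset.mem_product.2 ⟨a4, b4⟩⟩, ?_⟩
        exact fun h => hn (he.trans h)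
    · rintro ⟨t, _⟩ _ ⟨t', _⟩ _ he
      simp only [Prod.mk.injEq] at he
      obtain ⟨⟨⟨e1, e2⟩, e3, e4⟩, ⟨e5, e6⟩, e7, e8⟩ := he
      exact Subtype.ext (Prod.ext (Prod.ext e1 (Prod.ext e3 (Prod.ext e5 e7)))
        (Prod.ext e2 (Prod.ext e4 (Prod.ext e6 e8))))
  have h2 : ((S ×ˢ S).filter (fun z => f z.1 = f z.2)).card ≤ (A ×ˢ B).card *
      ((S ×ˢ S).filter (fun z => f z.1 = f z.2 ∧ z.1.1 = z.2.1)).card := by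
    convert cs2 S (A ×ˢ B) f Prod.fst
      (fun s hs => (Finset.mem_product.1 (Finset.mem_filter.1 hs).1).1)
  refine h1.trans (h2.trans ?_)
  rw [Finset.card_product]
  refine Nat.mul_le_mul_left _ ?_
  refine Finset.card_le_card_of_injOn
    (fun z => ((z.1.1, (lam * z.1.2.1, mu * z.2.2.2)), (lam * z.2.2.1, mu * z.1.2.2))) ?_ ?_
  · rintro ⟨⟨⟨a1, b1⟩, a2, b2⟩, ⟨⟨a1', b1'⟩, a3, b3⟩⟩ hz
    obtain ⟨hz1, hz2, hz3⟩ := Finset.mem_filter.1 hz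
    obtain ⟨s1, s2⟩ := Finset.mem_product.1 hz1
    obtain ⟨s3, s4⟩ := Finset.mem_filter.1 s1
    obtain ⟨s5, s6⟩ := Finset.mem_filter.1 s2
    simp only [Finset.mem_product] at s3 s5
    simp only [Prod.mk.injEq] at hz3
    obtain ⟨rfl, rfl⟩ := hz3
    obtain ⟨⟨m1, m2⟩, m3, m4⟩ := s3
    obtain ⟨_, m5, m6⟩ := s5
    simp only [hf] at s4 s6 hz2
    have n1 := left_ne_zero_of_mul s4
    refine Finset.mem_coe.2 (Finset.mem_filter.2 ⟨?_, sub_ne_zero.1 n1, ?_⟩)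
    · simp only [Finset.mem_product]
      exact ⟨⟨⟨m1, m2⟩, Finset.mem_image_of_mem _ m3, Finset.mem_image_of_mem _ m6⟩,
        Finset.mem_image_of_mem _ m5, Finset.mem_image_of_mem _ m4⟩
    · simp only [lf]
      field_simp
      linear_combination hz2
  · rintro ⟨⟨⟨a1, b1⟩, a2, b2⟩, ⟨⟨a1', b1'⟩, a3, b3⟩⟩ hz ⟨⟨⟨c1, d1⟩, c2, d2⟩, ⟨⟨c1', d1'⟩, c3, d3⟩⟩ hz' he
    have hz3 := (Finset.mem_filter.1 hz).2.2
    have hz3' := (Finset.mem_filter.1 hz').2.2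
    simp only [Prod.mk.injEq] at hz3 hz3' he ⊢
    obtain ⟨⟨⟨e1, e2⟩, e3, e4⟩, e5, e6⟩ := he
    have := mul_left_cancel₀ hl e3
    have := mul_left_cancel₀ hm e4
    have := mul_left_cancel₀ hl e5
    have := mul_left_cancel₀ hm e6
    grind

end Final
end DS

/-- Lemma 2.6: `D*_{λ,μ}(A,B) ≤ c (p^{1/2} A³ B^{5/2} + A⁴B⁴/p)`. -/
theorem Dstar_bound :
    ∃ c : ℝ, 0 < c ∧ ∀ (p : ℕ) (_ : Fact p.Prime) (A B : Finset (ZMod p))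
      (lam mu : ZMod p), lam ≠ 0 → mu ≠ 0 → A.card ≤ B.card →
      (Dstar A B lam mu : ℝ)
        ≤ c * ((p : ℝ) ^ ((1 : ℝ) / 2) * (A.card : ℝ) ^ 3 * (B.card : ℝ) ^ ((5 : ℝ) / 2)
            + (A.card : ℝ) ^ 4 * (B.card : ℝ) ^ 4 / p) := by
  classical
  refine ⟨10 ^ 17, by norm_num, ?_⟩
  intro p _ A B lam mu hl hm hAB
  have h1 := DS.Dstar_le A B lam mu hl hm
  have hp : (0 : ℝ) < p := by exact_mod_cast (Fact.out : p.Prime).pos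
  rcases Nat.eq_zero_or_pos A.card with h0 | hA
  · rw [h0, zero_mul, zero_mul, Nat.le_zero] at h1
    rw [h1, Nat.cast_zero]
    positivity
  have h2 := DS.Wt_bound A B (A.image (fun x => lam * x)) (B.image (fun x => mu * x)) hAB hA
    (Finset.card_image_of_injective _ (mul_right_injective₀ hl))
    (Finset.card_image_of_injective _ (mul_right_injective₀ hm))
  have h3 : (Dstar A B lam mu : ℝ) ≤ (A.card * B.card) *
      (DS.Wt A B (A.image (fun x => lam * x)) (B.image (fun x => mu * x))).card := by
    exact_mod_cast h1
  have hb : (0 : ℝ) < B.card := by exact_mod_cast hA.trans_le hAB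
  have h5 : (B.card : ℝ) ^ ((5 : ℝ) / 2) = (B.card : ℝ) ^ 2 * √B.card := by
    rw [Real.sqrt_eq_rpow, ← Real.rpow_natCast, ← Real.rpow_add hb]
    norm_num
  rw [h5, ← Real.sqrt_eq_rpow]
  refine h3.trans ((mul_le_mul_of_nonneg_left h2 (by positivity)).trans ?_)
  have h6 : 0 ≤ (A.card : ℝ) ^ 4 * (B.card : ℝ) ^ 4 / p := by positivity
  have h7 : ((A.card : ℝ) * B.card) * (2 * ((A.card : ℝ) ^ 3 * B.card ^ 3 / p)) =
    2 * ((A.card : ℝ) ^ 4 * (B.card : ℝ) ^ 4 / p) := by ring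
  rw [mul_add, h7]
  nlinarith
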